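/- arXiv:2305.00707 — 2 statements merged into one kernel-verified Lean document; each statement's English description precedes it below -/
import Mathlib

section
/- Let 𝔛 = (X, {R_i}_{i=0}^ℓ) be a commutative association scheme of class ℓ and n ≥ 1. Then the extension S^n(𝔛) = (X^n, ℛ), whose primitive idempotents E_α (α ∈ D := {α ∈ ℕ^ℓ : |α| ≤ n}) are the symmetrized tensors of the primitive idempotents E_0,…,E_ℓ of 𝔛, is an ℓ-variate Q-polynomial association scheme on D with respect to the graded lexicographic order ≤_grlex. -/
open scoped BigOperators
open Matrix

noncomputable section

/-- The all-ones matrix `J`. -/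
def matJ (X : Type*) : Matrix X X ℂ := Matrix.of fun _ _ => 1

/-- A family of matrices `A : ι → Matrix X X ℂ` forms a commutative association scheme:
0-1 matrices summing to `J`, containing the identity, closed under transpose, whose
pairwise products are linear combinations of the family and commute. -/
structure IsAssocScheme {X ι : Type*} [Fintype X] [DecidableEq X] [Fintype ι]
    (A : ι → Matrix X X ℂ) : Prop where
  entries_zero_one : ∀ (i : ι) (x y : X), A i x y = 0 ∨ A i x y = 1
  sum_eq_J : ∑ i, A i = matJ X
  exists_id : ∃ i₀, A i₀ = 1
  exists_transpose : ∀ i, ∃ i', (A i)ᵀ = A i'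
  mul_eq_lin : ∀ i j, ∃ p : ι → ℂ, A i * A j = ∑ k, p k • A k
  mul_comm' : ∀ i j, A i * A j = A j * A i

/-- A monomial order on `ℕ^ℓ`: a total well-ordering compatible with addition. -/
structure MonOrder (ℓ : ℕ) where
  le : (Fin ℓ → ℕ) → (Fin ℓ → ℕ) → Prop
  le_refl : ∀ a, le a a
  le_trans : ∀ a b c, le a b → le b c → le a c
  le_antisymm : ∀ a b, le a b → le b a → a = b
  le_total : ∀ a b, le a b ∨ le b a
  wf : WellFounded fun a b => le a b ∧ a ≠ b
  add_compat : ∀ a b c, le a b → le (a + c) (b + c)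

/-- The `i`-th standard unit vector of `ℕ^ℓ`. -/
def epsV {ℓ : ℕ} (i : Fin ℓ) : Fin ℓ → ℕ := Pi.single i 1

/-- Conversion from `Fin ℓ → ℕ` to exponents of `MvPolynomial`. -/
def toExp {ℓ : ℕ} (α : Fin ℓ → ℕ) : Fin ℓ →₀ ℕ := Finsupp.equivFunOnFinite.symm α

/-- `α` is the multidegree of `f` with respect to the monomial order `mo`. -/
def IsMultideg {ℓ : ℕ} (mo : MonOrder ℓ) (f : MvPolynomial (Fin ℓ) ℂ) (α : Fin ℓ → ℕ) : Prop :=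
  MvPolynomial.coeff (toExp α) f ≠ 0 ∧ ∀ d ∈ f.support, mo.le (⇑d) α

/-- The ordered monomial `M 1 ^ α 1 * ⋯ * M ℓ ^ α ℓ`. -/
def mpow {X : Type*} [Fintype X] [DecidableEq X] {ℓ : ℕ}
    (M : Fin ℓ → Matrix X X ℂ) (α : Fin ℓ → ℕ) : Matrix X X ℂ :=
  ((List.finRange ℓ).map fun i => M i ^ α i).prod

/-- Evaluation of a multivariate polynomial at a family of matrices. -/
def matEval {X : Type*} [Fintype X] [DecidableEq X] {ℓ : ℕ}
    (f : MvPolynomial (Fin ℓ) ℂ) (M : Fin ℓ → Matrix X X ℂ) : Matrix X X ℂ :=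
  ∑ d ∈ f.support, MvPolynomial.coeff d f • mpow M (⇑d)

/-- `ℓ`-variate `P`-polynomial association scheme on the domain `D` with respect to the
monomial order `mo`, with adjacency matrices (relabeled) `A α` for `α ∈ D`. -/
structure IsMultiPPoly {X : Type*} [Fintype X] [DecidableEq X] {ℓ : ℕ}
    (D : Finset (Fin ℓ → ℕ)) (mo : MonOrder ℓ)
    (A : (Fin ℓ → ℕ) → Matrix X X ℂ) : Prop where
  scheme : IsAssocScheme fun α : {a // a ∈ D} => A α.1
  eps_mem : ∀ i : Fin ℓ, epsV i ∈ D
  lower_closed : ∀ α ∈ D, ∀ β : Fin ℓ → ℕ, (∀ i, β i ≤ α i) → β ∈ D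
  exists_poly : ∀ α ∈ D, ∃ v : MvPolynomial (Fin ℓ) ℂ,
    A α = matEval v (fun i => A (epsV i)) ∧ IsMultideg mo v α ∧
      ∀ d ∈ v.support, ⇑d ∈ D
  recur : ∀ i : Fin ℓ, ∀ α ∈ D, ∃ c : (Fin ℓ → ℕ) → ℂ,
    (A (epsV i) * mpow (fun j => A (epsV j)) α
        = ∑ β ∈ D, c β • mpow (fun j => A (epsV j)) β) ∧
      ∀ β ∈ D, c β ≠ 0 → mo.le β (α + epsV i)

/-- The Hadamard (entrywise) monomial `E 1 ^{∘ α 1} ∘ ⋯ ∘ E ℓ ^{∘ α ℓ}`. -/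
def hpow {X : Type*} {ℓ : ℕ} (E : Fin ℓ → Matrix X X ℂ) (α : Fin ℓ → ℕ) : Matrix X X ℂ :=
  Matrix.of fun x y => ∏ i, (E i x y) ^ α i

/-- Evaluation of a multivariate polynomial at a family of matrices under the
Hadamard product. -/
def hEval {X : Type*} {ℓ : ℕ}
    (f : MvPolynomial (Fin ℓ) ℂ) (E : Fin ℓ → Matrix X X ℂ) : Matrix X X ℂ :=
  ∑ d ∈ f.support, MvPolynomial.coeff d f • hpow E (⇑d)

/-- `E` is the family of primitive idempotents of the Bose–Mesner algebra spanned by `A`. -/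
structure IsPrimIdem {X ι κ : Type*} [Fintype X] [DecidableEq X] [Fintype ι] [Fintype κ]
    (A : ι → Matrix X X ℂ) (E : κ → Matrix X X ℂ) : Prop where
  idem : ∀ j, E j * E j = E j
  orth : ∀ j k, j ≠ k → E j * E k = 0
  sum_eq_one : ∑ j, E j = 1
  span_eq : Submodule.span ℂ (Set.range E) = Submodule.span ℂ (Set.range A)

/-- `ℓ`-variate `Q`-polynomial association scheme on the domain `D` with respect to the
monomial order `mo`; `A` are the adjacency matrices and `E α` for `α ∈ D` the (relabeled)
primitive idempotents. -/
structure IsMultiQPoly {X ι : Type*} [Fintype X] [DecidableEq X] [Fintype ι] {ℓ : ℕ}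
    (D : Finset (Fin ℓ → ℕ)) (mo : MonOrder ℓ)
    (A : ι → Matrix X X ℂ) (E : (Fin ℓ → ℕ) → Matrix X X ℂ) : Prop where
  scheme : IsAssocScheme A
  primIdem : IsPrimIdem A fun α : {a // a ∈ D} => E α.1
  eps_mem : ∀ i : Fin ℓ, epsV i ∈ D
  lower_closed : ∀ α ∈ D, ∀ β : Fin ℓ → ℕ, (∀ i, β i ≤ α i) → β ∈ D
  exists_poly : ∀ α ∈ D, ∃ v : MvPolynomial (Fin ℓ) ℂ,
    (Fintype.card X : ℂ) • E α
        = hEval v (fun i => (Fintype.card X : ℂ) • E (epsV i)) ∧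
      IsMultideg mo v α ∧ ∀ d ∈ v.support, ⇑d ∈ D
  recur : ∀ i : Fin ℓ, ∀ α ∈ D, ∃ c : (Fin ℓ → ℕ) → ℂ,
    (Matrix.hadamard (E (epsV i)) (hpow (fun j => E (epsV j)) α)
        = ∑ β ∈ D, c β • hpow (fun j => E (epsV j)) β) ∧
      ∀ β ∈ D, c β ≠ 0 → mo.le β (α + epsV i)

/-- The graded lexicographic order on `ℕ^ℓ`. -/
def grlexLe {ℓ : ℕ} (a b : Fin ℓ → ℕ) : Prop :=
  (∑ i, a i) < (∑ i, b i) ∨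
    ((∑ i, a i) = (∑ i, b i) ∧
      (a = b ∨ ∃ i, (∀ j, j < i → a j = b j) ∧ a i < b i))

/-- The lexicographic order on `ℕ^ℓ`. -/
def lexLe {ℓ : ℕ} (a b : Fin ℓ → ℕ) : Prop :=
  a = b ∨ ∃ i, (∀ j, j < i → a j = b j) ∧ a i < b i

/-- Evaluation of a univariate polynomial at a matrix under the Hadamard product. -/
def hEval1 {X : Type*} (v : Polynomial ℂ) (M : Matrix X X ℂ) : Matrix X X ℂ :=
  ∑ n ∈ v.support, v.coeff n • Matrix.of fun x y => (M x y) ^ n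

end

open scoped Classical

section Extension

variable {X : Type*} [Fintype X] [DecidableEq X]

/-- The adjacency matrices of the extension `S^n(𝔛)` on `X^n`: `x, y` are in relation
`α ∈ ℕ^ℓ` iff `τ_i(x,y) = |{t : (x_t, y_t) ∈ R_i}| = α i` for `i = 1,…,ℓ`. -/
noncomputable def extA (ℓ n : ℕ) (A : ℕ → Matrix X X ℂ) :
    (Fin ℓ → ℕ) → Matrix (Fin n → X) (Fin n → X) ℂ :=
  fun α => Matrix.of fun x y =>
    if ∀ i : Fin ℓ,
        (Finset.univ.filter fun t : Fin n => A ((i : ℕ) + 1) (x t) (y t) = 1).card = α i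
    then 1 else 0

/-- The primitive idempotents of the extension `S^n(𝔛)`: the symmetrized tensors of the
primitive idempotents `E_0, …, E_ℓ` of `𝔛` (each distinct place-permutation of
`E_1^{⊗ α 1} ⊗ ⋯ ⊗ E_ℓ^{⊗ α ℓ} ⊗ E_0^{⊗ (n - |α|)}` appearing exactly once). -/
noncomputable def extE (ℓ n : ℕ) (E : ℕ → Matrix X X ℂ) :
    (Fin ℓ → ℕ) → Matrix (Fin n → X) (Fin n → X) ℂ :=
  fun α => Matrix.of fun x y =>
    ∑ g ∈ Finset.univ.filter (fun g : Fin n → Fin (ℓ + 1) =>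
        ∀ i : Fin ℓ, (Finset.univ.filter fun t => g t = Fin.succ i).card = α i),
      ∏ t, E ((g t : ℕ)) (x t) (y t)

/-- The domain `D = {α ∈ ℕ^ℓ : |α| ≤ n}` of the extension. -/
def extD (ℓ n : ℕ) : Finset (Fin ℓ → ℕ) :=
  (Fintype.piFinset fun _ : Fin ℓ => Finset.range (n + 1)).filter fun α => ∑ i, α i ≤ n

end Extension

section DegreeFiltration

open Finsupp

variable {σ K R : Type*} [Field K] [CommRing R] [Algebra K R]

/-- The span of the members of a family whose index has degree less than `d`. -/
def degSpan (K : Type*) {σ R : Type*} [Field K] [CommRing R] [Algebra K R]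
    (F : (σ →₀ ℕ) → R) (d : ℕ) : Submodule K R :=
  Submodule.span K (F '' {b | b.degree < d})

theorem mem_degSpan {F : (σ →₀ ℕ) → R} {b : σ →₀ ℕ} {d : ℕ} (h : b.degree < d) :
    F b ∈ degSpan K F d :=
  Submodule.subset_span ⟨b, h, rfl⟩

theorem degSpan_mono (F : (σ →₀ ℕ) → R) {d d' : ℕ} (h : d ≤ d') :
    degSpan K F d ≤ degSpan K F d' :=
  Submodule.span_mono (Set.image_mono fun _ hb => lt_of_lt_of_le hb h)

/-- The monomial with exponent `b` in the members of `F` of degree one. -/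
noncomputable def monomialEval (F : (σ →₀ ℕ) → R) (b : σ →₀ ℕ) : R :=
  b.prod fun i k => F (single i 1) ^ k

theorem monomialEval_add_single (F : (σ →₀ ℕ) → R) (b : σ →₀ ℕ) (i : σ) :
    monomialEval F (b + single i 1) = F (single i 1) * monomialEval F b := by
  unfold monomialEval
  rw [Finsupp.prod_add_index' (by simp) (by intros; exact pow_add _ _ _),
    Finsupp.prod_single_index (by simp), pow_one, mul_comm]

theorem mul_mem_degSpan {F : (σ →₀ ℕ) → R}
    (hrec : ∀ i b, F (single i 1) * F b - ((b i : K) + 1) • F (b + single i 1) ∈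
      degSpan K F (b.degree + 1)) (i : σ) {d : ℕ} {v : R} (hv : v ∈ degSpan K F d) :
    F (single i 1) * v ∈ degSpan K F (d + 1) := by
  induction hv using Submodule.span_induction with
  | mem x hx =>
    obtain ⟨b, hb, rfl⟩ := hx
    have hb : b.degree < d := hb
    rw [← sub_add_cancel (F (single i 1) * F b) (((b i : K) + 1) • F (b + single i 1))]
    refine add_mem (degSpan_mono F (by omega) (hrec i b))
      (Submodule.smul_mem _ _ (mem_degSpan ?_))
    simp only [map_add, degree_single]
    omega
  | zero => simp
  | add x y _ _ hx hy => rw [mul_add]; exact add_mem hx hy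
  | smul c x _ hx => rw [mul_smul_comm]; exact Submodule.smul_mem _ _ hx

theorem exists_monomialEval_sub_mem [CharZero K] {F : (σ →₀ ℕ) → R} (h0 : F 0 = 1)
    (hrec : ∀ i b, F (single i 1) * F b - ((b i : K) + 1) • F (b + single i 1) ∈
      degSpan K F (b.degree + 1)) (b : σ →₀ ℕ) :
    ∃ c : K, c ≠ 0 ∧ monomialEval F b - c • F b ∈ degSpan K F b.degree := by
  induction hd : b.degree generalizing b with
  | zero =>
    obtain rfl : b = 0 := (Finsupp.degree_eq_zero_iff b).1 hd
    exact ⟨1, one_ne_zero, by simp [monomialEval, h0]⟩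
  | succ d ih =>
    obtain ⟨i, hi⟩ : ∃ i, b i ≠ 0 := by
      by_contra! h
      obtain rfl : b = 0 := Finsupp.ext h
      simp at hd
    obtain ⟨a, rfl⟩ : ∃ a, b = a + Finsupp.single i 1 :=
      ⟨b - Finsupp.single i 1,
        (tsub_add_cancel_of_le (by simpa using Nat.one_le_iff_ne_zero.2 hi)).symm⟩
    have ha : a.degree = d := by simpa using hd
    obtain ⟨c, hc, hmem⟩ := ih a ha
    refine ⟨c * ((a i : K) + 1), mul_ne_zero hc (Nat.cast_add_one_ne_zero _), ?_⟩
    have h1 := mul_mem_degSpan hrec i hmem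
    have h2 := Submodule.smul_mem _ c (hrec i a)
    rw [ha] at h2
    convert add_mem h1 h2 using 1
    rw [monomialEval_add_single, mul_sub, mul_smul_comm, smul_sub, smul_smul]
    abel

theorem degSpan_monomialEval [CharZero K] {F : (σ →₀ ℕ) → R} (h0 : F 0 = 1)
    (hrec : ∀ i b, F (single i 1) * F b - ((b i : K) + 1) • F (b + single i 1) ∈
      degSpan K F (b.degree + 1)) (d : ℕ) :
    degSpan K (monomialEval F) d = degSpan K F d := by
  induction d with
  | zero => simp [degSpan]
  | succ d ih =>
    apply le_antisymm <;> refine Submodule.span_le.2 ?_ <;> rintro _ ⟨b, hb, rfl⟩ <;>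
      have hb : b.degree ≤ d := Nat.lt_succ_iff.1 hb <;>
      obtain ⟨c, hc, hmem⟩ := exists_monomialEval_sub_mem h0 hrec b
    · have := add_mem (degSpan_mono F (hb.trans d.le_succ) hmem)
        (Submodule.smul_mem _ c (mem_degSpan (F := F) (Nat.lt_succ_iff.2 hb)))
      simpa using this
    · have h1 : monomialEval F b - c • F b ∈ degSpan K (monomialEval F) (d + 1) :=
        degSpan_mono _ d.le_succ (ih ▸ degSpan_mono F hb hmem)
      have h2 := Submodule.smul_mem _ c⁻¹ (sub_mem
        (mem_degSpan (K := K) (F := monomialEval F) (Nat.lt_succ_iff.2 hb)) h1)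
      simpa [smul_smul, hc] using h2

theorem exists_aeval_eq_of_mem_degSpan {F : (σ →₀ ℕ) → R} {d : ℕ} {v : R}
    (hv : v ∈ degSpan K (monomialEval F) d) :
    ∃ p : MvPolynomial σ K, MvPolynomial.aeval (fun i => F (single i 1)) p = v ∧
      ∀ b ∈ p.support, b.degree < d := by
  induction hv using Submodule.span_induction with
  | mem x hx =>
    obtain ⟨b, hb, rfl⟩ := hx
    refine ⟨MvPolynomial.monomial b 1, by simp [MvPolynomial.aeval_monomial, monomialEval], ?_⟩
    intro b' hb'
    rwa [Finset.mem_singleton.1 (MvPolynomial.support_monomial_subset hb')]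
  | zero => exact ⟨0, by simp⟩
  | add x y _ _ hx hy =>
    obtain ⟨p, rfl, hp⟩ := hx
    obtain ⟨r, rfl, hr⟩ := hy
    refine ⟨p + r, map_add _ _ _, fun b hb => ?_⟩
    rcases Finset.mem_union.1 (MvPolynomial.support_add hb) with h | h
    exacts [hp b h, hr b h]
  | smul c x _ hx =>
    obtain ⟨p, rfl, hp⟩ := hx
    exact ⟨c • p, map_smul _ _ _, fun b hb => hp b (MvPolynomial.support_smul hb)⟩

/-- Each member of the family is a polynomial in the members of degree one, with leading
monomial of the same index and all other monomials of smaller degree. -/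
theorem exists_aeval_eq [CharZero K] {F : (σ →₀ ℕ) → R} (h0 : F 0 = 1)
    (hrec : ∀ i b, F (single i 1) * F b - ((b i : K) + 1) • F (b + single i 1) ∈
      degSpan K F (b.degree + 1)) (b : σ →₀ ℕ) :
    ∃ p : MvPolynomial σ K, MvPolynomial.aeval (fun i => F (single i 1)) p = F b ∧
      p.coeff b ≠ 0 ∧ ∀ d ∈ p.support, d.degree < b.degree ∨ d = b := by
  obtain ⟨c, hc, hmem⟩ := exists_monomialEval_sub_mem h0 hrec b
  rw [← degSpan_monomialEval h0 hrec] at hmem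
  obtain ⟨p, hp, hdeg⟩ := exists_aeval_eq_of_mem_degSpan hmem
  have hpb : p.coeff b = 0 := by
    by_contra h
    exact lt_irrefl _ (hdeg b (MvPolynomial.mem_support_iff.2 h))
  refine ⟨c⁻¹ • (MvPolynomial.monomial b 1 - p), ?_, ?_, fun d hd => ?_⟩
  · have hm : MvPolynomial.aeval (fun i => F (single i 1)) (MvPolynomial.monomial b (1 : K)) =
        monomialEval F b := by simp [MvPolynomial.aeval_monomial, monomialEval]
    rw [map_smul, map_sub, hp, hm, sub_sub_cancel, smul_smul, inv_mul_cancel₀ hc, one_smul]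
  · simp [hpb, hc]
  · rcases Finset.mem_union.1 (MvPolynomial.support_sub σ _ _ (MvPolynomial.support_smul hd))
      with h | h
    exacts [Or.inr (Finset.mem_singleton.1 (MvPolynomial.support_monomial_subset h)),
      Or.inl (hdeg d h)]

end DegreeFiltration

section GeneratingFunction

open Finsupp MvPolynomial

variable {K R : Type*} [Field K] [CommRing R] [Algebra K R] {ℓ n : ℕ}

/-- The variables of `MvPolynomial (Fin ℓ) R`, preceded by `1`. -/
noncomputable def zetaVar (ℓ : ℕ) (R : Type*) [CommRing R] : Fin (ℓ + 1) → MvPolynomial (Fin ℓ) R :=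
  Fin.cons 1 X

/-- The linear factor `e 0 t + ∑ j, e (j + 1) t z_j`. -/
noncomputable def genFactor (e : Fin (ℓ + 1) → Fin n → R) (t : Fin n) : MvPolynomial (Fin ℓ) R :=
  ∑ j, C (e j t) * zetaVar ℓ R j

/-- The generating function `∏ t, (e 0 t + ∑ j, e (j + 1) t z_j)`. -/
noncomputable def genFun (e : Fin (ℓ + 1) → Fin n → R) : MvPolynomial (Fin ℓ) R :=
  ∏ t, genFactor e t

/-- The sum over `t` of the generating function with its factor at `t` replaced by `e k t`. -/
noncomputable def genDeriv (e : Fin (ℓ + 1) → Fin n → R) (k : Fin (ℓ + 1)) : MvPolynomial (Fin ℓ) R :=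
  ∑ t, C (e k t) * ∏ s ∈ Finset.univ.erase t, genFactor e s

theorem genFactor_eq (e : Fin (ℓ + 1) → Fin n → R) (t : Fin n) :
    genFactor e t = C (e 0 t) + ∑ j : Fin ℓ, C (e j.succ t) * X j := by
  simp [genFactor, zetaVar, Fin.sum_univ_succ]

theorem genFactor_mul_prod_erase (e : Fin (ℓ + 1) → Fin n → R) (t : Fin n) :
    genFactor e t * ∏ s ∈ Finset.univ.erase t, genFactor e s = genFun e :=
  Finset.mul_prod_erase _ _ (Finset.mem_univ t)

theorem pderiv_genFun (e : Fin (ℓ + 1) → Fin n → R) (k : Fin ℓ) :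
    pderiv k (genFun e) = genDeriv e k.succ := by
  have hfac (t : Fin n) : pderiv k (genFactor e t) = C (e k.succ t) := by
    simp [genFactor_eq, Derivation.leibniz, pderiv_X, Pi.single_apply]
  have key (s : Finset (Fin n)) : pderiv k (∏ t ∈ s, genFactor e t) =
      ∑ t ∈ s, C (e k.succ t) * ∏ u ∈ s.erase t, genFactor e u := by
    induction s using Finset.induction_on with
    | empty => simp
    | insert a s ha ih =>
      rw [Finset.prod_insert ha, pderiv_mul, ih, hfac, Finset.sum_insert ha,
        Finset.erase_insert ha, Finset.mul_sum]
      congr 1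
      refine Finset.sum_congr rfl fun t ht => ?_
      have hta : a ≠ t := fun h => ha (h ▸ ht)
      rw [Finset.erase_insert_of_ne hta, Finset.prod_insert (by simp [ha])]
      ring
  exact key Finset.univ

/-- Euler's identity for the homogenized generating function. -/
theorem genDeriv_zero {e : Fin (ℓ + 1) → Fin n → R} (he0 : ∀ t, e 0 t = 1) :
    genDeriv e 0 = (n : MvPolynomial (Fin ℓ) R) * genFun e -
      ∑ k : Fin ℓ, X k * pderiv k (genFun e) := by
  have h : (n : MvPolynomial (Fin ℓ) R) * genFun e =
      ∑ t, genFactor e t * ∏ s ∈ Finset.univ.erase t, genFactor e s := by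
    simp [genFactor_mul_prod_erase]
  rw [h, eq_sub_iff_add_eq]
  simp only [pderiv_genFun, genDeriv, Finset.mul_sum]
  rw [Finset.sum_comm, ← Finset.sum_add_distrib]
  refine Finset.sum_congr rfl fun t _ => ?_
  rw [genFactor_eq, he0, add_mul, Finset.sum_mul]
  congr 1
  exact Finset.sum_congr rfl fun k _ => by ring

theorem C_sum_mul_genFun {e : Fin (ℓ + 1) → Fin n → R}
    {q : Fin (ℓ + 1) → Fin (ℓ + 1) → Fin (ℓ + 1) → K} (he0 : ∀ t, e 0 t = 1)
    (he : ∀ i j t, e i t * e j t = ∑ k, q i j k • e k t) (i : Fin (ℓ + 1)) :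
    C (∑ t, e i t) * genFun e =
      genDeriv e i + ∑ j : Fin ℓ, X j * ∑ k, q i j.succ k • genDeriv e k := by
  have hstep (t : Fin n) : C (e i t) * genFun e =
      C (e i t) * (∏ s ∈ Finset.univ.erase t, genFactor e s) +
        ∑ j : Fin ℓ, X j * ∑ k, q i j.succ k • (C (e k t) *
          ∏ s ∈ Finset.univ.erase t, genFactor e s) := by
    rw [← genFactor_mul_prod_erase e t, genFactor_eq, he0, ← mul_assoc, mul_add, add_mul,
      Finset.mul_sum, Finset.sum_mul, map_one, mul_one]
    congr 1
    refine Finset.sum_congr rfl fun j _ => ?_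
    have hC : C (e i t) * C (e j.succ t) =
        ∑ k, q i j.succ k • (C (e k t) : MvPolynomial (Fin ℓ) R) := by
      rw [← C_mul, he, map_sum]
      refine Finset.sum_congr rfl fun k _ => ?_
      ext m
      simp only [coeff_smul, coeff_C]
      split_ifs <;> simp
    rw [← mul_assoc, hC, mul_comm _ (X j), mul_assoc, Finset.sum_mul]
    simp only [smul_mul_assoc]
  rw [map_sum, Finset.sum_mul, Finset.sum_congr rfl fun t _ => hstep t, Finset.sum_add_distrib]
  congr 1
  rw [Finset.sum_comm]
  refine Finset.sum_congr rfl fun j _ => ?_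
  rw [← Finset.mul_sum, Finset.sum_comm]
  simp only [genDeriv, Finset.smul_sum]

theorem coeff_zero_genFun {e : Fin (ℓ + 1) → Fin n → R} (he0 : ∀ t, e 0 t = 1) :
    coeff 0 (genFun e) = 1 := by
  rw [← constantCoeff_eq]
  simp [genFun, genFactor_eq, he0]

theorem coeff_single_genFun {e : Fin (ℓ + 1) → Fin n → R} (he0 : ∀ t, e 0 t = 1) (i : Fin ℓ) :
    coeff (Finsupp.single i 1) (genFun e) = ∑ t, e i.succ t := by
  have h := coeff_pderiv (i := i) (genFun e) 0
  rw [pderiv_genFun, ← constantCoeff_eq] at h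
  simpa [genDeriv, genFactor_eq, he0] using h.symm

theorem coeff_X_mul_mem_degSpan {F : (Fin ℓ →₀ ℕ) → R} {P : MvPolynomial (Fin ℓ) R} {d : ℕ}
    (hP : ∀ b, coeff b P ∈ degSpan K F (b.degree + 1 + d)) (j : Fin ℓ) (b : Fin ℓ →₀ ℕ) :
    coeff b (X j * P) ∈ degSpan K F (b.degree + d) := by
  rw [coeff_X_mul']
  split_ifs with h
  · obtain ⟨a, rfl⟩ : ∃ a, b = a + Finsupp.single j 1 :=
      ⟨b - Finsupp.single j 1, (tsub_add_cancel_of_le (by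
        simpa using Nat.one_le_iff_ne_zero.2 (Finsupp.mem_support_iff.1 h))).symm⟩
    simpa using hP a
  · exact zero_mem _

theorem coeff_pderiv_genFun_mem_degSpan (e : Fin (ℓ + 1) → Fin n → R) (k : Fin ℓ)
    (b : Fin ℓ →₀ ℕ) :
    coeff b (pderiv k (genFun e)) ∈
      degSpan K (fun a => coeff a (genFun e)) (b.degree + 1 + 1) := by
  have h : coeff b (pderiv k (genFun e)) =
      ((b k : K) + 1) • coeff (b + Finsupp.single k 1) (genFun e) := by
    rw [coeff_pderiv, mul_comm, Algebra.smul_def]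
    simp
  rw [h]
  exact Submodule.smul_mem _ _ (mem_degSpan (F := fun a => coeff a (genFun e)) (by simp))

theorem coeff_genDeriv_mem_degSpan {e : Fin (ℓ + 1) → Fin n → R} (he0 : ∀ t, e 0 t = 1)
    (k : Fin (ℓ + 1)) (b : Fin ℓ →₀ ℕ) :
    coeff b (genDeriv e k) ∈ degSpan K (fun a => coeff a (genFun e)) (b.degree + 1 + 1) := by
  refine Fin.cases ?_ (fun k => ?_) k
  · have h : coeff b ((n : MvPolynomial (Fin ℓ) R) * genFun e) =
        (n : K) • coeff b (genFun e) := by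
      rw [← nsmul_eq_mul, coeff_smul, Nat.cast_smul_eq_nsmul]
    rw [genDeriv_zero he0, coeff_sub, h, coeff_sum]
    refine sub_mem (Submodule.smul_mem _ _
      (mem_degSpan (F := fun a => coeff a (genFun e)) (by omega))) (sum_mem fun k _ => ?_)
    exact degSpan_mono _ (by omega) (coeff_X_mul_mem_degSpan (d := 1)
      (coeff_pderiv_genFun_mem_degSpan e k) k b)
  · rw [← pderiv_genFun]
    exact coeff_pderiv_genFun_mem_degSpan e k b

theorem coeff_single_mul_coeff_genFun_sub_mem {e : Fin (ℓ + 1) → Fin n → R}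
    {q : Fin (ℓ + 1) → Fin (ℓ + 1) → Fin (ℓ + 1) → K} (he0 : ∀ t, e 0 t = 1)
    (he : ∀ i j t, e i t * e j t = ∑ k, q i j k • e k t) (i : Fin ℓ) (b : Fin ℓ →₀ ℕ) :
    coeff (Finsupp.single i 1) (genFun e) * coeff b (genFun e) -
        ((b i : K) + 1) • coeff (b + Finsupp.single i 1) (genFun e) ∈
      degSpan K (fun a => coeff a (genFun e)) (b.degree + 1) := by
  have h : ((b i : K) + 1) • coeff (b + Finsupp.single i 1) (genFun e) =
      coeff b (genDeriv e i.succ) := by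
    rw [← pderiv_genFun, coeff_pderiv, mul_comm, Algebra.smul_def]
    simp
  rw [coeff_single_genFun he0, ← coeff_C_mul, C_sum_mul_genFun he0 he, h, coeff_add,
    add_sub_cancel_left, coeff_sum]
  refine sum_mem fun j _ => coeff_X_mul_mem_degSpan (fun a => ?_) j b
  rw [coeff_sum]
  refine sum_mem fun k _ => ?_
  rw [coeff_smul]
  exact Submodule.smul_mem _ _ (coeff_genDeriv_mem_degSpan he0 k a)

end GeneratingFunction

section WordType

variable {ℓ n : ℕ}

/-- The number of occurrences of each nonzero letter in a word. -/
def wordType (g : Fin n → Fin (ℓ + 1)) (i : Fin ℓ) : ℕ :=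
  (Finset.univ.filter fun t => g t = Fin.succ i).card

theorem sum_card_letter (g : Fin n → Fin (ℓ + 1)) :
    ∑ j, (Finset.univ.filter fun t => g t = j).card = n := by
  simpa using (Finset.card_eq_sum_card_fiberwise (f := g) (s := Finset.univ)
    (t := Finset.univ) (by simp)).symm

theorem card_zero_add_sum_wordType (g : Fin n → Fin (ℓ + 1)) :
    (Finset.univ.filter fun t => g t = 0).card + ∑ i, wordType g i = n :=
  (Fin.sum_univ_succ fun j => (Finset.univ.filter fun t => g t = j).card).symm.trans
    (sum_card_letter g)

theorem mem_extD {α : Fin ℓ → ℕ} : α ∈ extD ℓ n ↔ ∑ i, α i ≤ n := by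
  simp only [extD, Finset.mem_filter, Fintype.mem_piFinset, Finset.mem_range, and_iff_right_iff_imp]
  exact fun h i => Nat.lt_succ_iff.2
    ((Finset.single_le_sum (fun _ _ => Nat.zero_le _) (Finset.mem_univ i)).trans h)

theorem wordType_mem_extD (g : Fin n → Fin (ℓ + 1)) : wordType g ∈ extD ℓ n := by
  have := card_zero_add_sum_wordType g
  exact mem_extD.2 (by omega)

theorem card_letter_eq_of_wordType_eq {g h : Fin n → Fin (ℓ + 1)} (hgh : wordType g = wordType h)
    (j : Fin (ℓ + 1)) :
    (Finset.univ.filter fun t => g t = j).card = (Finset.univ.filter fun t => h t = j).card := by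
  refine Fin.cases ?_ (fun i => congrFun hgh i) j
  have h1 := card_zero_add_sum_wordType g
  have h2 := card_zero_add_sum_wordType h
  rw [hgh] at h1
  omega

theorem wordType_comp_eq_of_wordType_eq {g h : Fin n → Fin (ℓ + 1)}
    (hgh : wordType g = wordType h) (f : Fin (ℓ + 1) → Fin (ℓ + 1)) :
    wordType (f ∘ g) = wordType (f ∘ h) := by
  have key (g : Fin n → Fin (ℓ + 1)) (i : Fin ℓ) : wordType (f ∘ g) i =
      ∑ j ∈ Finset.univ.filter (fun j => f j = i.succ),
        (Finset.univ.filter fun t => g t = j).card := by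
    rw [wordType, Finset.card_eq_sum_card_fiberwise (f := g)
      (t := Finset.univ.filter fun j => f j = i.succ) (by intro t; simp)]
    refine Finset.sum_congr rfl fun j hj => ?_
    congr 1
    ext t
    have hj := (Finset.mem_filter.1 hj).2
    simp only [Function.comp_apply, Finset.mem_filter, Finset.mem_univ, true_and,
      and_iff_right_iff_imp]
    rintro rfl
    exact hj
  funext i
  rw [key, key]
  exact Finset.sum_congr rfl fun j _ => card_letter_eq_of_wordType_eq hgh j

theorem prod_word {S : Type*} [CommMonoid S] (w : Fin (ℓ + 1) → S) (g : Fin n → Fin (ℓ + 1)) :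
    ∏ t, w (g t) = w 0 ^ (n - ∑ i, wordType g i) * ∏ i : Fin ℓ, w i.succ ^ wordType g i := by
  have h := card_zero_add_sum_wordType g
  rw [← Finset.prod_fiberwise' Finset.univ g w, Fin.prod_univ_succ]
  simp only [Finset.prod_const]
  rw [show n - ∑ i, wordType g i = (Finset.univ.filter fun t => g t = 0).card by omega]
  rfl

/-- The sum over words of type `α` of the products of the letters' values. -/
def wordSum {R : Type*} [CommRing R] (e : Fin (ℓ + 1) → Fin n → R) (α : Fin ℓ → ℕ) : R :=
  ∑ g ∈ Finset.univ.filter (fun g : Fin n → Fin (ℓ + 1) => wordType g = α), ∏ t, e (g t) t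

theorem wordSum_eq_zero {R : Type*} [CommRing R] (e : Fin (ℓ + 1) → Fin n → R) {α : Fin ℓ → ℕ}
    (hα : α ∉ extD ℓ n) : wordSum e α = 0 := by
  refine Finset.sum_eq_zero fun g hg => absurd ?_ hα
  exact (Finset.mem_filter.1 hg).2 ▸ wordType_mem_extD g

theorem prod_sum_eq_sum_wordSum {R : Type*} [CommRing R] (e : Fin (ℓ + 1) → Fin n → R)
    (w : Fin (ℓ + 1) → R) :
    ∏ t, ∑ j, e j t * w j =
      ∑ α ∈ extD ℓ n, wordSum e α * (w 0 ^ (n - ∑ i, α i) * ∏ i : Fin ℓ, w i.succ ^ α i) := by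
  rw [Finset.prod_univ_sum, Fintype.piFinset_univ,
    ← Finset.sum_fiberwise_of_maps_to (g := wordType) fun g _ => wordType_mem_extD g]
  refine Finset.sum_congr rfl fun α _ => ?_
  rw [wordSum, Finset.sum_mul]
  refine Finset.sum_congr rfl fun g hg => ?_
  rw [Finset.prod_mul_distrib, prod_word w g, (Finset.mem_filter.1 hg).2]

open MvPolynomial in
theorem coeff_genFun {R : Type*} [CommRing R] (e : Fin (ℓ + 1) → Fin n → R) (α : Fin ℓ → ℕ) :
    coeff (toExp α) (genFun e) = wordSum e α := by
  have hz (β : Fin ℓ → ℕ) : zetaVar ℓ R 0 ^ (n - ∑ i, β i) *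
      ∏ i : Fin ℓ, zetaVar ℓ R i.succ ^ β i = monomial (toExp β) 1 := by
    rw [monomial_eq, Finsupp.prod_fintype _ _ (by simp)]
    simp [zetaVar, toExp]
  have hC (β : Fin ℓ → ℕ) : wordSum (fun j t => (C (e j t) : MvPolynomial (Fin ℓ) R)) β =
      C (wordSum e β) := by
    simp [wordSum]
  simp only [genFun, genFactor]
  rw [prod_sum_eq_sum_wordSum (fun j t => C (e j t)), coeff_sum]
  simp only [hz, hC, coeff_C_mul, coeff_monomial]
  simp only [toExp, EmbeddingLike.apply_eq_iff_eq, mul_ite, mul_one, mul_zero,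
    Finset.sum_ite_eq']
  split_ifs with h
  · rfl
  · exact (wordSum_eq_zero e h).symm

/-- A linear substitution in the letters induces a linear substitution in the word sums. -/
theorem exists_wordSum_eq {K : Type*} [Field K] (c : Fin (ℓ + 1) → Fin (ℓ + 1) → K)
    (α : Fin ℓ → ℕ) :
    ∃ p : (Fin ℓ → ℕ) → K, ∀ e e' : Fin (ℓ + 1) → Fin n → K,
      (∀ j t, e j t = ∑ k, c j k * e' k t) →
        wordSum e α = ∑ β ∈ extD ℓ n, p β * wordSum e' β := by
  let w : Fin (ℓ + 1) → MvPolynomial (Fin ℓ) K :=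
    fun k => ∑ j, MvPolynomial.C (c j k) * zetaVar ℓ K j
  refine ⟨fun β => MvPolynomial.coeff (toExp α)
    (w 0 ^ (n - ∑ i, β i) * ∏ i : Fin ℓ, w i.succ ^ β i), fun e e' he => ?_⟩
  have hfac (t : Fin n) : genFactor e t = ∑ k, MvPolynomial.C (e' k t) * w k := by
    simp only [genFactor, he, w, map_sum, map_mul, Finset.sum_mul, Finset.mul_sum]
    rw [Finset.sum_comm]
    exact Finset.sum_congr rfl fun k _ => Finset.sum_congr rfl fun j _ => by ring
  have hC (β : Fin ℓ → ℕ) :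
      wordSum (fun j t => (MvPolynomial.C (e' j t) : MvPolynomial (Fin ℓ) K)) β =
        MvPolynomial.C (wordSum e' β) := by
    simp [wordSum]
  rw [← coeff_genFun, genFun, Finset.prod_congr rfl fun t _ => hfac t,
    prod_sum_eq_sum_wordSum (fun j t => MvPolynomial.C (e' j t)), MvPolynomial.coeff_sum]
  refine Finset.sum_congr rfl fun β _ => ?_
  rw [hC, MvPolynomial.coeff_C_mul, mul_comm]

end WordType

section SchemeAlgebra

variable {X ι κ : Type*} [Fintype X] [DecidableEq X] [Fintype ι] [Fintype κ]

/-- The relation map of an association scheme. -/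
theorem IsAssocScheme.exists_rel [DecidableEq ι] {A : ι → Matrix X X ℂ} (hA : IsAssocScheme A) :
    ∃ r : X → X → ι, ∀ i x y, A i x y = if i = r x y then 1 else 0 := by
  have key (x y : X) : ∃ k, ∀ i, A i x y = if i = k then 1 else 0 := by
    have hval (i : ι) : A i x y = if A i x y = 1 then 1 else 0 := by
      rcases hA.entries_zero_one i x y with h | h <;> simp [h]
    have hsum : ∑ i, A i x y = 1 := by
      rw [← Matrix.sum_apply, hA.sum_eq_J]
      rfl
    rw [Finset.sum_congr rfl fun i _ => hval i, Finset.sum_boole, Nat.cast_eq_one,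
      Finset.card_eq_one] at hsum
    obtain ⟨k, hk⟩ := hsum
    refine ⟨k, fun i => (hval i).trans ?_⟩
    have : A i x y = 1 ↔ i = k := by simpa using Finset.ext_iff.1 hk i
    simp only [this]
  choose r hr using key
  exact ⟨r, fun i x y => hr x y i⟩

theorem IsAssocScheme.hadamard_mem_span {A : ι → Matrix X X ℂ} (hA : IsAssocScheme A)
    {M N : Matrix X X ℂ} (hM : M ∈ Submodule.span ℂ (Set.range A))
    (hN : N ∈ Submodule.span ℂ (Set.range A)) :
    Matrix.hadamard M N ∈ Submodule.span ℂ (Set.range A) := by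
  obtain ⟨r, hr⟩ := hA.exists_rel
  obtain ⟨c, rfl⟩ := (Submodule.mem_span_range_iff_exists_fun ℂ).1 hM
  obtain ⟨d, rfl⟩ := (Submodule.mem_span_range_iff_exists_fun ℂ).1 hN
  refine (Submodule.mem_span_range_iff_exists_fun ℂ).2 ⟨fun i => c i * d i, ?_⟩
  ext x y
  simp [Matrix.sum_apply, hr]

theorem sum_smul_mul_sum_smul {E : κ → Matrix X X ℂ} (hidem : ∀ j, E j * E j = E j)
    (horth : ∀ j k, j ≠ k → E j * E k = 0) (c d : κ → ℂ) :
    (∑ j, c j • E j) * (∑ j, d j • E j) = ∑ j, (c j * d j) • E j := by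
  rw [Finset.sum_mul]
  refine Finset.sum_congr rfl fun j _ => ?_
  rw [Finset.mul_sum, Finset.sum_eq_single j]
  · rw [smul_mul_smul_comm, hidem]
  · intro k _ hk
    rw [smul_mul_smul_comm, horth j k hk.symm, smul_zero]
  · simp

theorem IsPrimIdem.mul_mem_span {A : ι → Matrix X X ℂ} {E : κ → Matrix X X ℂ}
    (hE : IsPrimIdem A E) {M N : Matrix X X ℂ} (hM : M ∈ Submodule.span ℂ (Set.range A))
    (hN : N ∈ Submodule.span ℂ (Set.range A)) :
    M * N ∈ Submodule.span ℂ (Set.range A) := by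
  rw [← hE.span_eq] at *
  obtain ⟨c, rfl⟩ := (Submodule.mem_span_range_iff_exists_fun ℂ).1 hM
  obtain ⟨d, rfl⟩ := (Submodule.mem_span_range_iff_exists_fun ℂ).1 hN
  rw [sum_smul_mul_sum_smul hE.idem hE.orth]
  exact (Submodule.mem_span_range_iff_exists_fun ℂ).2 ⟨_, rfl⟩

theorem IsPrimIdem.mul_comm_of_mem_span {A : ι → Matrix X X ℂ} {E : κ → Matrix X X ℂ}
    (hE : IsPrimIdem A E) {M N : Matrix X X ℂ} (hM : M ∈ Submodule.span ℂ (Set.range A))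
    (hN : N ∈ Submodule.span ℂ (Set.range A)) : M * N = N * M := by
  rw [← hE.span_eq] at *
  obtain ⟨c, rfl⟩ := (Submodule.mem_span_range_iff_exists_fun ℂ).1 hM
  obtain ⟨d, rfl⟩ := (Submodule.mem_span_range_iff_exists_fun ℂ).1 hN
  simp only [sum_smul_mul_sum_smul hE.idem hE.orth, mul_comm]

end SchemeAlgebra

section ExtensionScheme

variable {X : Type*} {ℓ n : ℕ}

theorem extE_apply (M : ℕ → Matrix X X ℂ) (α : Fin ℓ → ℕ) (x y : Fin n → X) :
    extE ℓ n M α x y = wordSum (fun j t => M j (x t) (y t)) α := by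
  simp only [extE, wordSum, Matrix.of_apply]
  refine Finset.sum_congr (Finset.filter_congr fun g _ => ?_) fun _ _ => rfl
  exact (funext_iff (f := wordType g)).symm

/-- The Kronecker product along a word. -/
noncomputable def wordMatrix (M : ℕ → Matrix X X ℂ) (g : Fin n → Fin (ℓ + 1)) :
    Matrix (Fin n → X) (Fin n → X) ℂ :=
  Matrix.of fun x y => ∏ t, M (g t) (x t) (y t)

theorem extE_eq_sum_wordMatrix (M : ℕ → Matrix X X ℂ) (α : Fin ℓ → ℕ) :
    extE ℓ n M α = ∑ g ∈ Finset.univ.filter (fun g : Fin n → Fin (ℓ + 1) => wordType g = α),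
      wordMatrix M g := by
  ext x y
  simp [extE_apply, wordSum, wordMatrix, Matrix.sum_apply]

theorem wordMatrix_mul_apply [Fintype X]
    (M : ℕ → Matrix X X ℂ) (g h : Fin n → Fin (ℓ + 1))
    (x y : Fin n → X) :
    (wordMatrix M g * wordMatrix M h) x y = ∏ t, (M (g t) * M (h t)) (x t) (y t) := by
  simp only [Matrix.mul_apply, wordMatrix, Matrix.of_apply, ← Finset.prod_mul_distrib]
  rw [Finset.prod_univ_sum, Fintype.piFinset_univ]

theorem wordMatrix_mul [Fintype X] [DecidableEq X]
    {E : ℕ → Matrix X X ℂ} {ι : Type*} [Fintype ι] {A : ι → Matrix X X ℂ}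
    (hE : IsPrimIdem A fun j : Fin (ℓ + 1) => E j) (g h : Fin n → Fin (ℓ + 1)) :
    wordMatrix E g * wordMatrix E h = if g = h then wordMatrix E g else 0 := by
  ext x y
  rw [wordMatrix_mul_apply]
  split_ifs with hgh
  · subst hgh
    exact Finset.prod_congr rfl fun t _ => by rw [hE.idem (g t)]
  · obtain ⟨t, ht⟩ := Function.ne_iff.1 hgh
    exact Finset.prod_eq_zero (Finset.mem_univ t) (by rw [hE.orth _ _ ht]; rfl)

theorem extE_mul [Fintype X] [DecidableEq X]
    {E : ℕ → Matrix X X ℂ} {ι : Type*} [Fintype ι] {A : ι → Matrix X X ℂ}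
    (hE : IsPrimIdem A fun j : Fin (ℓ + 1) => E j) (α β : Fin ℓ → ℕ) :
    extE ℓ n E α * extE ℓ n E β = if α = β then extE ℓ n E α else 0 := by
  simp only [extE_eq_sum_wordMatrix, Finset.sum_mul_sum, wordMatrix_mul hE, Finset.sum_ite_eq,
    Finset.mem_filter, Finset.mem_univ, true_and]
  split_ifs with h
  · subst h
    exact Finset.sum_congr rfl fun g hg => if_pos (Finset.mem_filter.1 hg).2
  · exact Finset.sum_eq_zero fun g hg =>
      if_neg fun hg' => h ((Finset.mem_filter.1 hg).2.symm.trans hg')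

theorem sum_extE [DecidableEq X]
    {E : ℕ → Matrix X X ℂ} (hE : ∑ j : Fin (ℓ + 1), E j = 1) :
    ∑ α : {a // a ∈ extD ℓ n}, extE ℓ n E α.1 = 1 := by
  rw [Finset.sum_coe_sort (extD ℓ n) (extE ℓ n E)]
  simp only [extE_eq_sum_wordMatrix]
  rw [Finset.sum_fiberwise_of_maps_to (g := wordType) fun g _ => wordType_mem_extD g]
  ext x y
  have h : ∏ t, ∑ j : Fin (ℓ + 1), E j (x t) (y t) = ∏ t, (1 : Matrix X X ℂ) (x t) (y t) :=
    Finset.prod_congr rfl fun t _ => by rw [← hE, Matrix.sum_apply]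
  rw [Finset.prod_univ_sum, Fintype.piFinset_univ] at h
  simp only [Matrix.sum_apply, wordMatrix, Matrix.of_apply, h, Matrix.one_apply,
    Finset.prod_ite_zero, funext_iff]
  simp

theorem extE_mem_span {M N : ℕ → Matrix X X ℂ}
    (h : ∀ j : Fin (ℓ + 1),
      M j ∈ Submodule.span ℂ (Set.range fun k : Fin (ℓ + 1) => N k)) (α : Fin ℓ → ℕ) :
    extE ℓ n M α ∈
      Submodule.span ℂ (Set.range fun β : {a // a ∈ extD ℓ n} => extE ℓ n N β.1) := by
  choose c hc using fun j => (Submodule.mem_span_range_iff_exists_fun ℂ).1 (h j)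
  obtain ⟨p, hp⟩ := exists_wordSum_eq (n := n) c α
  refine (Submodule.mem_span_range_iff_exists_fun ℂ).2 ⟨fun β => p β.1, ?_⟩
  rw [Finset.sum_coe_sort (extD ℓ n) fun β => p β • extE ℓ n N β]
  ext x y
  rw [extE_apply, hp _ fun k t => N k (x t) (y t)]
  · simp [Matrix.sum_apply, extE_apply]
  · intro j t
    simp [← hc, Matrix.sum_apply]

variable {A : ℕ → Matrix X X ℂ} {r : X → X → Fin (ℓ + 1)}

theorem extA_apply (hr : ∀ (i : Fin (ℓ + 1)) x y, A i x y = if i = r x y then 1 else 0)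
    (α : Fin ℓ → ℕ) (x y : Fin n → X) :
    extA ℓ n A α x y = if wordType (fun t => r (x t) (y t)) = α then 1 else 0 := by
  have h (i : Fin ℓ) (x y : X) : A ((i : ℕ) + 1) x y = 1 ↔ r x y = i.succ := by
    have := hr i.succ x y
    rw [Fin.val_succ] at this
    rw [this]
    simp [eq_comm]
  simp only [extA, Matrix.of_apply, h, funext_iff, wordType]

theorem extA_eq_extE (hr : ∀ (i : Fin (ℓ + 1)) x y, A i x y = if i = r x y then 1 else 0)
    (α : Fin ℓ → ℕ) : extA ℓ n A α = extE ℓ n A α := by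
  ext x y
  have h (g : Fin n → Fin (ℓ + 1)) : (∏ t, if g t = r (x t) (y t) then (1 : ℂ) else 0) =
      if g = fun t => r (x t) (y t) then 1 else 0 := by
    simp [Finset.prod_ite_zero, funext_iff]
  simp [extA_apply hr, extE_apply, wordSum, hr, h]

theorem extE_isPrimIdem [Fintype X] [DecidableEq X]
    {E : ℕ → Matrix X X ℂ}
    (hr : ∀ (i : Fin (ℓ + 1)) x y, A i x y = if i = r x y then 1 else 0)
    (hE : IsPrimIdem (fun i : Fin (ℓ + 1) => A i) fun j : Fin (ℓ + 1) => E j) :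
    IsPrimIdem (fun α : {a // a ∈ extD ℓ n} => extA ℓ n A α.1)
      fun α : {a // a ∈ extD ℓ n} => extE ℓ n E α.1 where
  idem α := by simp [extE_mul hE]
  orth α β h := by simp [extE_mul hE, Subtype.coe_injective.ne h]
  sum_eq_one := sum_extE hE.sum_eq_one
  span_eq := by
    simp only [extA_eq_extE hr]
    apply le_antisymm <;> refine Submodule.span_le.2 ?_ <;> rintro _ ⟨α, rfl⟩ <;>
      refine extE_mem_span (fun j => ?_) α.1
    · exact hE.span_eq ▸ Submodule.subset_span ⟨j, rfl⟩
    · exact hE.span_eq.symm ▸ Submodule.subset_span ⟨j, rfl⟩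

theorem extA_isAssocScheme [Fintype X] [DecidableEq X]
    {E : ℕ → Matrix X X ℂ}
    (hA : IsAssocScheme fun i : Fin (ℓ + 1) => A i) (hA0 : A 0 = 1)
    (hE : IsPrimIdem (fun i : Fin (ℓ + 1) => A i) fun j : Fin (ℓ + 1) => E j) :
    IsAssocScheme fun α : {a // a ∈ extD ℓ n} => extA ℓ n A α.1 := by
  obtain ⟨r, hr⟩ := hA.exists_rel
  have hP := extE_isPrimIdem (n := n) hr hE
  have hmem (α : {a // a ∈ extD ℓ n}) : extA ℓ n A α.1 ∈
      Submodule.span ℂ (Set.range fun α : {a // a ∈ extD ℓ n} => extA ℓ n A α.1) :=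
    Submodule.subset_span ⟨α, rfl⟩
  refine ⟨fun α x y => ?_, ?_, ⟨⟨0, mem_extD.2 (by simp)⟩, ?_⟩, fun α => ?_, fun α β => ?_,
    fun α β => hP.mul_comm_of_mem_span (hmem α) (hmem β)⟩
  · rw [extA_apply hr]
    split_ifs <;> simp
  · rw [Finset.sum_coe_sort (extD ℓ n) (extA ℓ n A)]
    ext x y
    simp [Matrix.sum_apply, extA_apply hr, wordType_mem_extD, matJ]
  · ext x y
    have h0 (x y : X) : r x y = 0 ↔ x = y := by
      have := hr 0 x y
      simp only [Fin.val_zero, hA0, Matrix.one_apply] at this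
      rw [eq_comm (a := r x y)]
      by_cases h : x = y <;> by_cases h' : 0 = r x y <;> simp_all
    have hz (g : Fin n → Fin (ℓ + 1)) : wordType g = 0 ↔ ∀ t, g t = 0 := by
      refine ⟨fun h t => ?_, fun h => ?_⟩
      · by_contra ht
        obtain ⟨i, hi⟩ := Fin.exists_succ_eq.2 ht
        have := Finset.card_eq_zero.1 (congrFun h i)
        simpa [hi] using Finset.ext_iff.1 this t
      · funext i
        simp [wordType, h, (Fin.succ_ne_zero i).symm]
    simp [extA_apply hr, hz, h0, Matrix.one_apply, funext_iff]
  · choose s hs using hA.exists_transpose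
    have htr (x y : X) : r x y = s (r y x) := by
      have h1 := congrFun (congrFun (hs (r y x)) x) y
      simp only [Matrix.transpose_apply, hr, if_true] at h1
      by_contra h
      rw [if_neg (Ne.symm h)] at h1
      exact one_ne_zero h1
    have hswap {x y u v : Fin n → X}
        (h : wordType (fun t => r (x t) (y t)) = wordType (fun t => r (u t) (v t))) :
        wordType (fun t => r (y t) (x t)) = wordType (fun t => r (v t) (u t)) := by
      have := wordType_comp_eq_of_wordType_eq h s
      simpa only [Function.comp_def, ← htr] using this
    by_cases hα : ∃ x y : Fin n → X, wordType (fun t => r (x t) (y t)) = α.1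
    · obtain ⟨x, y, hxy⟩ := hα
      refine ⟨⟨wordType fun t => r (y t) (x t), wordType_mem_extD _⟩, ?_⟩
      ext u v
      simp only [Matrix.transpose_apply, extA_apply hr, ← hxy]
      exact if_congr ⟨hswap, hswap⟩ rfl rfl
    · push Not at hα
      refine ⟨α, ?_⟩
      ext u v
      simp [extA_apply hr, hα]
  · obtain ⟨p, hp⟩ := (Submodule.mem_span_range_iff_exists_fun ℂ).1
      (hP.mul_mem_span (hmem α) (hmem β))
    exact ⟨p, hp.symm⟩

end ExtensionScheme

section QPolynomial

open MvPolynomial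

variable {X : Type*} {ℓ n : ℕ}

theorem hpow_apply (M : Fin ℓ → Matrix X X ℂ) (α : Fin ℓ → ℕ) (x y : X) :
    hpow M α x y = ∏ i, M i x y ^ α i :=
  rfl

theorem hEval_apply (p : MvPolynomial (Fin ℓ) ℂ) (M : Fin ℓ → Matrix X X ℂ) (x y : X) :
    hEval p M x y = aeval (fun i => M i x y) p := by
  simp [hEval, hpow_apply, aeval_def, eval₂_eq', Matrix.sum_apply]

theorem aeval_pi_apply (p : MvPolynomial (Fin ℓ) ℂ) (f : Fin ℓ → X → X → ℂ) (x y : X) :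
    aeval f p x y = aeval (fun i => f i x y) p := by
  simp [aeval_def, eval₂_eq', Finset.sum_apply, Finset.prod_apply]

theorem hpow_smul (c : ℂ) (M : Fin ℓ → Matrix X X ℂ) (α : Fin ℓ → ℕ) :
    hpow (fun i => c • M i) α = c ^ (∑ i, α i) • hpow M α := by
  ext x y
  simp [hpow_apply, mul_pow, Finset.prod_mul_distrib, Finset.prod_pow_eq_pow_sum]

theorem toExp_epsV (i : Fin ℓ) : toExp (epsV i) = Finsupp.single i 1 := by
  ext j
  simp [toExp, epsV, Finsupp.single_apply]

theorem toExp_add_epsV (α : Fin ℓ → ℕ) (i : Fin ℓ) :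
    toExp (α + epsV i) = toExp α + Finsupp.single i 1 := by
  rw [← toExp_epsV]
  ext j
  simp [toExp]

theorem toExp_coe (d : Fin ℓ →₀ ℕ) : toExp (⇑d) = d := by
  ext j
  rfl

theorem sum_add_epsV (α : Fin ℓ → ℕ) (i : Fin ℓ) : ∑ j, (α + epsV i) j = ∑ j, α j + 1 := by
  simp [epsV, Finset.sum_add_distrib]

theorem degree_toExp (α : Fin ℓ → ℕ) : (toExp α).degree = ∑ i, α i :=
  Finsupp.degree_eq_sum _

theorem grlexLe_of_degree_lt_or_eq {d : Fin ℓ →₀ ℕ} {α : Fin ℓ → ℕ}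
    (h : d.degree < (toExp α).degree ∨ d = toExp α) : grlexLe (⇑d) α := by
  rcases h with h | rfl
  · exact Or.inl (by rwa [degree_toExp, Finsupp.degree_eq_sum] at h)
  · exact Or.inr ⟨rfl, Or.inl rfl⟩

variable [Fintype X]

/-- The normalized entries of the matrices `E j`, as functions of a pair of words. -/
def scaledEntry (n : ℕ) (E : ℕ → Matrix X X ℂ) (j : Fin (ℓ + 1)) (t : Fin n) :
    (Fin n → X) → (Fin n → X) → ℂ :=
  fun x y => (Fintype.card X : ℂ) * E j (x t) (y t)

theorem wordSum_scaledEntry (E : ℕ → Matrix X X ℂ) (α : Fin ℓ → ℕ) (x y : Fin n → X) :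
    wordSum (scaledEntry n E) α x y =
      ((Fintype.card (Fin n → X) : ℂ) • extE ℓ n E α) x y := by
  simp [wordSum, scaledEntry, extE_apply, Finset.sum_apply, Finset.prod_apply,
    Finset.prod_mul_distrib, Finset.mul_sum]

theorem scaledEntry_zero {E : ℕ → Matrix X X ℂ} (hE0 : E 0 = (Fintype.card X : ℂ)⁻¹ • matJ X)
    (t : Fin n) : scaledEntry n E (0 : Fin (ℓ + 1)) t = 1 := by
  funext x y
  have : Nonempty X := ⟨x t⟩
  simp [scaledEntry, hE0, matJ]

theorem hEval_extE_apply (p : MvPolynomial (Fin ℓ) ℂ) (E : ℕ → Matrix X X ℂ)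
    (x y : Fin n → X) :
    hEval p (fun i => (Fintype.card (Fin n → X) : ℂ) • extE ℓ n E (epsV i)) x y =
      aeval (fun i => coeff (Finsupp.single i 1) (genFun (scaledEntry n E))) p x y := by
  simp only [hEval_apply, aeval_pi_apply, ← toExp_epsV, coeff_genFun, wordSum_scaledEntry]

variable [DecidableEq X]

/-- The existence of Krein numbers. -/
theorem exists_scaledEntry_mul {A E : ℕ → Matrix X X ℂ}
    (hA : IsAssocScheme fun i : Fin (ℓ + 1) => A i)
    (hE : IsPrimIdem (fun i : Fin (ℓ + 1) => A i) fun j : Fin (ℓ + 1) => E j) :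
    ∃ q : Fin (ℓ + 1) → Fin (ℓ + 1) → Fin (ℓ + 1) → ℂ, ∀ i j (t : Fin n),
      scaledEntry n E i t * scaledEntry n E j t = ∑ k, q i j k • scaledEntry n E k t := by
  have hmem (i : Fin (ℓ + 1)) : E i ∈ Submodule.span ℂ (Set.range fun i : Fin (ℓ + 1) => A i) :=
    hE.span_eq ▸ Submodule.subset_span ⟨i, rfl⟩
  have h (i j : Fin (ℓ + 1)) := hE.span_eq.symm ▸ hA.hadamard_mem_span (hmem i) (hmem j)
  choose q hq using fun i j => (Submodule.mem_span_range_iff_exists_fun ℂ).1 (h i j)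
  refine ⟨fun i j k => Fintype.card X * q i j k, fun i j t => ?_⟩
  funext x y
  have := congrFun (congrFun (hq i j) (x t)) (y t)
  simp only [Matrix.sum_apply, Matrix.smul_apply, Matrix.hadamard_apply, smul_eq_mul] at this
  simp only [scaledEntry, Pi.mul_apply, Finset.sum_apply, Pi.smul_apply, smul_eq_mul]
  rw [mul_mul_mul_comm, ← this, Finset.mul_sum]
  exact Finset.sum_congr rfl fun k _ => by ring

theorem exists_hEval_eq_extE {A E : ℕ → Matrix X X ℂ}
    (hA : IsAssocScheme fun i : Fin (ℓ + 1) => A i)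
    (hE : IsPrimIdem (fun i : Fin (ℓ + 1) => A i) fun j : Fin (ℓ + 1) => E j)
    (hE0 : E 0 = (Fintype.card X : ℂ)⁻¹ • matJ X) (α : Fin ℓ → ℕ) :
    ∃ v : MvPolynomial (Fin ℓ) ℂ,
      (Fintype.card (Fin n → X) : ℂ) • extE ℓ n E α =
        hEval v (fun i => (Fintype.card (Fin n → X) : ℂ) • extE ℓ n E (epsV i)) ∧
      v.coeff (toExp α) ≠ 0 ∧
      ∀ d ∈ v.support, d.degree < (toExp α).degree ∨ d = toExp α := by
  obtain ⟨q, hq⟩ := exists_scaledEntry_mul (n := n) hA hE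
  obtain ⟨v, hv, hc, hd⟩ := exists_aeval_eq
    (F := fun b => coeff b (genFun (scaledEntry n E))) (coeff_zero_genFun (scaledEntry_zero hE0))
    (coeff_single_mul_coeff_genFun_sub_mem (scaledEntry_zero hE0) hq) (toExp α)
  refine ⟨v, ?_, hc, hd⟩
  ext x y
  rw [hEval_extE_apply, hv, coeff_genFun, wordSum_scaledEntry]

theorem exists_hEval_eq_mul_hpow {A E : ℕ → Matrix X X ℂ}
    (hA : IsAssocScheme fun i : Fin (ℓ + 1) => A i)
    (hE : IsPrimIdem (fun i : Fin (ℓ + 1) => A i) fun j : Fin (ℓ + 1) => E j)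
    (hE0 : E 0 = (Fintype.card X : ℂ)⁻¹ • matJ X) (i : Fin ℓ) {α : Fin ℓ → ℕ} (hα : α ∈ extD ℓ n) :
    ∃ p : MvPolynomial (Fin ℓ) ℂ,
      Matrix.hadamard ((Fintype.card (Fin n → X) : ℂ) • extE ℓ n E (epsV i))
          (hpow (fun j => (Fintype.card (Fin n → X) : ℂ) • extE ℓ n E (epsV j)) α) =
        hEval p (fun j => (Fintype.card (Fin n → X) : ℂ) • extE ℓ n E (epsV j)) ∧
      ∀ d ∈ p.support, ⇑d ∈ extD ℓ n ∧ grlexLe (⇑d) (α + epsV i) := by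
  set F : (Fin ℓ →₀ ℕ) → (Fin n → X) → (Fin n → X) → ℂ :=
    fun b => coeff b (genFun (scaledEntry n E)) with hF
  have hmon : Matrix.hadamard ((Fintype.card (Fin n → X) : ℂ) • extE ℓ n E (epsV i))
      (hpow (fun j => (Fintype.card (Fin n → X) : ℂ) • extE ℓ n E (epsV j)) α) =
      Matrix.of (monomialEval F (toExp α + Finsupp.single i 1)) := by
    ext x y
    rw [monomialEval_add_single]
    simp only [monomialEval, Finsupp.prod_pow, hF, ← toExp_epsV, coeff_genFun,
      Matrix.hadamard_apply, Matrix.of_apply, Pi.mul_apply, Finset.prod_apply, Pi.pow_apply,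
      wordSum_scaledEntry, hpow_apply]
    rfl
  rw [hmon]
  have hdeg := mem_extD.1 hα
  rcases hdeg.lt_or_eq with hlt | heq
  · refine ⟨monomial (toExp (α + epsV i)) 1, ?_, fun d hd => ?_⟩
    · ext x y
      rw [hEval_extE_apply, aeval_monomial, map_one, one_mul, toExp_add_epsV]
      rfl
    · obtain rfl := Finset.mem_singleton.1 (support_monomial_subset hd)
      exact ⟨mem_extD.2 ((sum_add_epsV α i).trans_le hlt),
        grlexLe_of_degree_lt_or_eq (Or.inr rfl)⟩
  · obtain ⟨q, hq⟩ := exists_scaledEntry_mul (n := n) hA hE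
    have h0 : F 0 = 1 := coeff_zero_genFun (scaledEntry_zero hE0)
    have hrec := coeff_single_mul_coeff_genFun_sub_mem
      (scaledEntry_zero (n := n) (ℓ := ℓ) hE0) hq
    have hV (d : ℕ) : degSpan ℂ F d ≤ degSpan ℂ F (n + 1) := by
      refine Submodule.span_le.2 ?_
      rintro _ ⟨b, -, rfl⟩
      by_cases hb : b.degree < n + 1
      · exact mem_degSpan hb
      · have : F b = 0 := by
          rw [hF, ← toExp_coe b]
          simp only [coeff_genFun]
          refine wordSum_eq_zero _ fun h => hb ?_
          rw [Finsupp.degree_eq_sum]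
          exact Nat.lt_succ_iff.2 (mem_extD.1 h)
        rw [this]
        exact zero_mem _
    have hmem : monomialEval F (toExp α + Finsupp.single i 1) ∈
        degSpan ℂ (monomialEval F) (n + 1) := by
      rw [degSpan_monomialEval h0 hrec]
      refine hV (d := (toExp α + Finsupp.single i 1).degree + 1) ?_
      rw [← degSpan_monomialEval h0 hrec]
      exact mem_degSpan (Nat.lt_succ_self _)
    obtain ⟨p, hp, hd⟩ := exists_aeval_eq_of_mem_degSpan hmem
    refine ⟨p, ?_, fun d hd' => ?_⟩
    · ext x y
      rw [hEval_extE_apply, hp, Matrix.of_apply]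
    · have := hd d hd'
      rw [Finsupp.degree_eq_sum] at this
      refine ⟨mem_extD.2 (Nat.lt_succ_iff.1 this), Or.inl ?_⟩
      rwa [sum_add_epsV, heq]

theorem exists_hadamard_hpow_eq {A E : ℕ → Matrix X X ℂ}
    (hA : IsAssocScheme fun i : Fin (ℓ + 1) => A i)
    (hE : IsPrimIdem (fun i : Fin (ℓ + 1) => A i) fun j : Fin (ℓ + 1) => E j)
    (hE0 : E 0 = (Fintype.card X : ℂ)⁻¹ • matJ X) (i : Fin ℓ) {α : Fin ℓ → ℕ} (hα : α ∈ extD ℓ n) :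
    ∃ c : (Fin ℓ → ℕ) → ℂ,
      Matrix.hadamard (extE ℓ n E (epsV i)) (hpow (fun j => extE ℓ n E (epsV j)) α) =
          ∑ β ∈ extD ℓ n, c β • hpow (fun j => extE ℓ n E (epsV j)) β ∧
        ∀ β ∈ extD ℓ n, c β ≠ 0 → grlexLe β (α + epsV i) := by
  obtain ⟨p, hp, hd⟩ := exists_hEval_eq_mul_hpow (n := n) hA hE hE0 i hα
  rcases isEmpty_or_nonempty (Fin n → X) with hX | hX
  · exact ⟨0, Subsingleton.elim _ _, fun β _ h => absurd rfl h⟩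
  set N : ℂ := (Fintype.card (Fin n → X) : ℂ) with hN
  have hN0 : N ≠ 0 := Nat.cast_ne_zero.2 Fintype.card_ne_zero
  have hsum : hEval p (fun j => N • extE ℓ n E (epsV j)) =
      ∑ β ∈ extD ℓ n, (coeff (toExp β) p * N ^ (∑ j, β j)) •
        hpow (fun j => extE ℓ n E (epsV j)) β := by
    simp only [hEval, hpow_smul, smul_smul]
    refine Finset.sum_of_injOn (fun d => ⇑d) (fun _ _ _ _ h => DFunLike.coe_injective h)
      (fun d hd' => (hd d hd').1) (fun β _ hβ => ?_) fun d _ => by rw [toExp_coe]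
    have : coeff (toExp β) p = 0 := by
      by_contra h
      exact hβ ⟨toExp β, mem_support_iff.2 h, rfl⟩
    rw [this, zero_mul, zero_smul]
  rw [hsum, hpow_smul] at hp
  refine ⟨fun β => (N * N ^ (∑ j, α j))⁻¹ * (coeff (toExp β) p * N ^ (∑ j, β j)), ?_,
    fun β _ hβ => ?_⟩
  · simp only [mul_smul _ (coeff _ p * _), ← Finset.smul_sum]
    rw [← hp, Matrix.smul_hadamard, Matrix.hadamard_smul, smul_smul, smul_smul, mul_assoc _ N,
      inv_mul_cancel₀ (mul_ne_zero hN0 (pow_ne_zero _ hN0)), one_smul]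
  · have : coeff (toExp β) p ≠ 0 := fun h => hβ (by simp [h])
    exact (hd _ (mem_support_iff.2 this)).2

end QPolynomial

/-- Theorem 4.4 (Q-part): the extension `S^n(𝔛)` of a commutative association scheme `𝔛` of
class `ℓ`, whose primitive idempotents are the symmetrized tensors of the primitive
idempotents of `𝔛`, is an `ℓ`-variate `Q`-polynomial association scheme on
`D = {α : |α| ≤ n}` with respect to the graded lexicographic order. -/
theorem extension_isMultiQPoly {X : Type*} [Fintype X] [DecidableEq X] (ℓ n : ℕ)
    (hn : 1 ≤ n) (A : ℕ → Matrix X X ℂ) (E : ℕ → Matrix X X ℂ)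
    (hscheme : IsAssocScheme fun i : Fin (ℓ + 1) => A i)
    (hA0 : A 0 = 1)
    (hprim : IsPrimIdem (fun i : Fin (ℓ + 1) => A i) (fun j : Fin (ℓ + 1) => E j))
    (hE0 : E 0 = (Fintype.card X : ℂ)⁻¹ • matJ X)
    (mo : MonOrder ℓ) (hmo : mo.le = fun a b => grlexLe a b) :
    IsMultiQPoly (extD ℓ n) mo
      (fun α : {a // a ∈ extD ℓ n} => extA ℓ n A α.1) (extE ℓ n E) := by
  obtain ⟨r, hr⟩ := hscheme.exists_rel
  refine ⟨extA_isAssocScheme hscheme hA0 hprim, extE_isPrimIdem hr hprim,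
    fun i => mem_extD.2 (by simpa [epsV] using hn),
    fun α hα β h => mem_extD.2 ((Finset.sum_le_sum fun i _ => h i).trans (mem_extD.1 hα)),
    fun α hα => ?_, fun i α hα => ?_⟩
  · obtain ⟨v, hv, hc, hd⟩ := exists_hEval_eq_extE (n := n) hscheme hprim hE0 α
    refine ⟨v, hv, ⟨hc, fun d h => ?_⟩, fun d h => ?_⟩
    · rw [hmo]
      exact grlexLe_of_degree_lt_or_eq (hd d h)
    · rcases hd d h with h' | rfl
      · rw [degree_toExp, Finsupp.degree_eq_sum] at h'
        exact mem_extD.2 (h'.le.trans (mem_extD.1 hα))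
      · exact hα
  · rw [hmo]
    exact exists_hadamard_hpow_eq hscheme hprim hE0 i hα
end

section
/- Let (F,H) be a finite Gelfand pair, Y = F/H with H-orbits Λ₀ = {y₀}, Λ₁,…,Λ_m, and let 0 ≤ h ≤ n. Let Θ_h be the set of all functions θ : A → Y with A an h-subset of {1,…,n}, and define ℛ(θ₁,θ₂) = (t, a₁,…,a_m) by t = h − |dom θ₁ ∩ dom θ₂| and a_i = |{c ∈ dom θ₁ ∩ dom θ₂ : (θ₁(c),θ₂(c)) ∈ Λ̃_i}|, where Λ̃_i denotes the F-orbit of Y × Y corresponding to Λ_i. Then the generalized Johnson scheme 𝔛 = (Θ_h, ℛ) is an (m+1)-variate P-polynomial association scheme on the domain D := {(t,a₁,…,a_m) ∈ ℕ^{m+1} : 0 ≤ t ≤ min{h, n−h}, a_i ≥ 0, ∑_{i=1}^m a_i ≤ h−t} with respect to the graded lexicographic order ≤_grlex. -/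
open scoped BigOperators
open Matrix

open scoped Classical

section GeneralizedJohnson

/-- `Θ_h`: the set of all functions `θ : A → Y` whose domain `A` is an `h`-subset of
`{1, …, n}`. -/
abbrev Theta (Y : Type*) (n h : ℕ) : Type _ :=
  Σ A : {s : Finset (Fin n) // s.card = h}, (↥A.1 → Y)

/-- The adjacency matrices of the generalized Johnson scheme: `θ₁, θ₂` are in relation
`(t, a_1, …, a_m)` iff `t = h − |dom θ₁ ∩ dom θ₂|` and
`a_i = |{c ∈ dom θ₁ ∩ dom θ₂ : (θ₁(c), θ₂(c)) ∈ Λ̃_i}|`, where `ρ` labels the `F`-orbits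
`Λ̃_0, Λ̃_1, …, Λ̃_m` of `Y × Y`. -/
noncomputable def gjA (Y : Type*) [Fintype Y] [DecidableEq Y] (ρ : Y × Y → ℕ)
    (n h m : ℕ) : (Fin (m + 1) → ℕ) → Matrix (Theta Y n h) (Theta Y n h) ℂ :=
  fun α => Matrix.of fun θ₁ θ₂ =>
    if ((θ₁.1.1 ∩ θ₂.1.1).card + α 0 = h ∧
        ∀ i : Fin m,
          ((θ₁.1.1 ∩ θ₂.1.1).attach.filter fun c =>
            ρ (θ₁.2 ⟨c.1, (Finset.mem_inter.mp c.2).1⟩,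
               θ₂.2 ⟨c.1, (Finset.mem_inter.mp c.2).2⟩) = (i : ℕ) + 1).card = α i.succ)
    then 1 else 0

/-- The domain
`D = {(t, a_1, …, a_m) : 0 ≤ t ≤ min{h, n−h}, a_i ≥ 0, ∑ a_i ≤ h − t}`. -/
def gjD (n h m : ℕ) : Finset (Fin (m + 1) → ℕ) :=
  (Fintype.piFinset fun _ : Fin (m + 1) => Finset.range (h + 1)).filter fun α =>
    α 0 ≤ min h (n - h) ∧ (∑ i : Fin m, α i.succ) ≤ h - α 0

theorem exists_eq_add_epsV {ℓ : ℕ} {α : Fin ℓ → ℕ} (hα : ∑ i, α i ≠ 0) :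
    ∃ i β, α = β + epsV i := by
  obtain ⟨i, -, hi⟩ := Finset.exists_ne_zero_of_sum_ne_zero hα
  refine ⟨i, α - epsV i, ?_⟩
  ext j
  by_cases hj : j = i
  · subst hj
    simp only [epsV, Pi.add_apply, Pi.sub_apply, Pi.single_eq_same]
    omega
  · simp [epsV, hj]

theorem mpow_zero {X : Type*} [Fintype X] [DecidableEq X] {ℓ : ℕ}
    (M : Fin ℓ → Matrix X X ℂ) : mpow M 0 = 1 := by
  simp [mpow]

theorem mpow_add_epsV {X : Type*} [Fintype X] [DecidableEq X] {ℓ : ℕ}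
    {M : Fin ℓ → Matrix X X ℂ} (hM : ∀ i j, M i * M j = M j * M i)
    (α : Fin ℓ → ℕ) (i : Fin ℓ) : mpow M (α + epsV i) = M i * mpow M α := by
  have key : ∀ l : List (Fin ℓ), l.Nodup →
      (l.map fun j => M j ^ (α + epsV i) j).prod =
        if i ∈ l then M i * (l.map fun j => M j ^ α j).prod
        else (l.map fun j => M j ^ α j).prod := by
    intro l
    induction l with
    | nil => simp
    | cons a l ih =>
      intro hl
      rw [List.nodup_cons] at hl
      have ih := ih hl.2
      rw [List.map_cons, List.prod_cons, ih, List.map_cons, List.prod_cons]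
      by_cases hia : i = a
      · subst hia
        simp [hl.1, epsV, pow_succ', mul_assoc]
      · have hc : M a ^ α a * M i = M i * M a ^ α a :=
          ((show Commute (M a) (M i) from hM a i).pow_left (α a)).eq
        by_cases hil : i ∈ l
        · simp [hil, epsV, Ne.symm hia, ← mul_assoc, hc]
        · simp [hil, hia, epsV, Ne.symm hia]
  simpa [mpow] using key (List.finRange ℓ) (List.nodup_finRange ℓ)

theorem matEval_sum_monomial {X : Type*} [Fintype X] [DecidableEq X] {ℓ : ℕ}
    (D : Finset (Fin ℓ → ℕ)) (c : (Fin ℓ → ℕ) → ℂ) (M : Fin ℓ → Matrix X X ℂ) :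
    ∃ v : MvPolynomial (Fin ℓ) ℂ, matEval v M = ∑ β ∈ D, c β • mpow M β ∧
      (∀ β ∈ D, MvPolynomial.coeff (toExp β) v = c β) ∧
      ∀ d ∈ v.support, ⇑d ∈ D ∧ c d ≠ 0 := by
  have hcoe : ∀ β : Fin ℓ → ℕ, ⇑(toExp β) = β := fun β => rfl
  have hinj : ∀ β (d : Fin ℓ →₀ ℕ), toExp β = d ↔ β = ⇑d := by
    intro β d
    constructor
    · rintro rfl; rfl
    · rintro rfl; ext; rfl
  set v : MvPolynomial (Fin ℓ) ℂ := ∑ β ∈ D, MvPolynomial.monomial (toExp β) (c β) with hv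
  have hcoeff : ∀ d : Fin ℓ →₀ ℕ, v.coeff d = if ⇑d ∈ D then c d else 0 := by
    intro d
    simp [hv, MvPolynomial.coeff_sum, MvPolynomial.coeff_monomial, hinj]
  have hsupp : ∀ d ∈ v.support, ⇑d ∈ D ∧ c d ≠ 0 := by
    intro d hd
    rw [MvPolynomial.mem_support_iff, hcoeff] at hd
    by_cases h : ⇑d ∈ D
    · exact ⟨h, by simpa [h] using hd⟩
    · simp [h] at hd
  refine ⟨v, ?_, fun β hβ => by simp [hcoeff, hcoe, hβ], hsupp⟩
  rw [matEval]
  have himg : v.support ⊆ D.image toExp := by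
    intro d hd
    exact Finset.mem_image.mpr ⟨⇑d, (hsupp d hd).1, (hinj _ _).mpr rfl⟩
  rw [Finset.sum_subset himg, Finset.sum_image]
  · refine Finset.sum_congr rfl fun β hβ => ?_
    simp [hcoeff, hcoe, hβ]
  · intro a _ b _ hab
    exact (hinj a (toExp b)).mp hab
  · intro d _ hd
    simp [MvPolynomial.notMem_support_iff.mp hd]

theorem mem_span_image_filter_iff {V κ : Type*} [AddCommGroup V] [Module ℂ V]
    (f : κ → V) (D : Finset κ) (p : κ → Prop) (x : V) :
    x ∈ Submodule.span ℂ (f '' {β | β ∈ D ∧ p β}) ↔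
      ∃ c : κ → ℂ, x = ∑ β ∈ D, c β • f β ∧ ∀ β, c β ≠ 0 → p β := by
  constructor
  · intro hx
    have hset : {β | β ∈ D ∧ p β} = ((D.filter p : Finset κ) : Set κ) := by
      ext; simp
    rw [hset, Submodule.mem_span_image_finset_iff_exists_fun'] at hx
    obtain ⟨c, hc⟩ := hx
    refine ⟨fun β => if p β then c β else 0, ?_, fun β hβ => by_contra fun h => by simp [h] at hβ⟩
    rw [← hc, Finset.sum_filter]
    exact Finset.sum_congr rfl fun β _ => by by_cases h : p β <;> simp [h]
  · rintro ⟨c, rfl, hc⟩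
    refine Submodule.sum_mem _ fun β hβ => ?_
    by_cases h : c β = 0
    · simp [h]
    · exact Submodule.smul_mem _ _ (Submodule.subset_span ⟨β, ⟨hβ, hc β h⟩, rfl⟩)

/-- A commutative association scheme whose products `A (ε i) * A α` are triangular with respect to
a monomial order, with nonzero leading coefficients, is multivariate `P`-polynomial. -/
theorem IsMultiPPoly.of_triangular {X : Type*} [Fintype X] [DecidableEq X] {ℓ : ℕ}
    {D : Finset (Fin ℓ → ℕ)} {mo : MonOrder ℓ} {A : (Fin ℓ → ℕ) → Matrix X X ℂ}
    (hA : IsAssocScheme fun α : {a // a ∈ D} => A α.1)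
    (heps : ∀ i : Fin ℓ, epsV i ∈ D)
    (hlow : ∀ α ∈ D, ∀ β : Fin ℓ → ℕ, (∀ i, β i ≤ α i) → β ∈ D)
    (hone : A 0 = 1)
    (hstep : ∀ i, ∀ α ∈ D, ∃ c : (Fin ℓ → ℕ) → ℂ,
      A (epsV i) * A α = ∑ β ∈ D, c β • A β ∧
        (∀ β ∈ D, c β ≠ 0 → mo.le β (α + epsV i)) ∧
        (α + epsV i ∈ D → c (α + epsV i) ≠ 0)) :
    IsMultiPPoly D mo A := by
  set E : Fin ℓ → Matrix X X ℂ := fun i => A (epsV i) with hE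
  have hcomm : ∀ i j, E i * E j = E j * E i :=
    fun i j => hA.mul_comm' ⟨_, heps i⟩ ⟨_, heps j⟩
  have hlt : ∀ {a b c}, mo.le a b → mo.le b c ∧ b ≠ c → mo.le a c ∧ a ≠ c := by
    intro a b c hab hbc
    refine ⟨mo.le_trans _ _ _ hab hbc.1, ?_⟩
    rintro rfl
    exact hbc.2 (mo.le_antisymm _ _ hbc.1 hab)
  let W : ((Fin ℓ → ℕ) → Matrix X X ℂ) → (Fin ℓ → ℕ) → Submodule ℂ (Matrix X X ℂ) :=
    fun B α => Submodule.span ℂ (B '' {β | β ∈ D ∧ mo.le β α})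
  let S : ((Fin ℓ → ℕ) → Matrix X X ℂ) → (Fin ℓ → ℕ) → Submodule ℂ (Matrix X X ℂ) :=
    fun B α => Submodule.span ℂ (B '' {β | β ∈ D ∧ (mo.le β α ∧ β ≠ α)})
  have hWS : ∀ B {α γ}, mo.le α γ ∧ α ≠ γ → W B α ≤ S B γ := fun B α γ h =>
    Submodule.span_mono (Set.image_mono fun β hβ => ⟨hβ.1, hlt hβ.2 h⟩)
  have hWW : ∀ B {α γ}, mo.le α γ → W B α ≤ W B γ := fun B α γ h =>
    Submodule.span_mono (Set.image_mono fun β hβ => ⟨hβ.1, mo.le_trans _ _ _ hβ.2 h⟩)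
  have hSW : ∀ B α, S B α ≤ W B α := fun B α =>
    Submodule.span_mono (Set.image_mono fun β hβ => ⟨hβ.1, hβ.2.1⟩)
  have hmem : ∀ B, ∀ α ∈ D, B α ∈ W B α := fun B α h =>
    Submodule.subset_span ⟨α, ⟨h, mo.le_refl α⟩, rfl⟩
  have hEA : ∀ i, ∀ α ∈ D, E i * A α ∈ W A (α + epsV i) := by
    intro i α hα
    obtain ⟨c, hc, hle, -⟩ := hstep i α hα
    show A (epsV i) * A α ∈ _
    rw [hc]
    refine Submodule.sum_mem _ fun β hβ => ?_
    by_cases h : c β = 0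
    · simp [h]
    · exact Submodule.smul_mem _ _ (hWW A (hle β hβ h) (hmem A β hβ))
  have hEW : ∀ i α, ∀ x ∈ W A α, E i * x ∈ W A (α + epsV i) := by
    intro i α x hx
    induction hx using Submodule.span_induction with
    | mem x hx =>
      obtain ⟨β, hβ, rfl⟩ := hx
      exact hWW A (mo.add_compat _ _ _ hβ.2) (hEA i β hβ.1)
    | zero => simp
    | add x y _ _ hx hy => rw [mul_add]; exact add_mem hx hy
    | smul a x _ hx => rw [mul_smul_comm]; exact Submodule.smul_mem _ _ hx
  have hES : ∀ i α, ∀ x ∈ S A α, E i * x ∈ S A (α + epsV i) := by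
    intro i α x hx
    induction hx using Submodule.span_induction with
    | mem x hx =>
      obtain ⟨β, hβ, rfl⟩ := hx
      refine hWS A ⟨mo.add_compat _ _ _ hβ.2.1, fun h => hβ.2.2 (add_right_cancel h)⟩
        (hEA i β hβ.1)
    | zero => simp
    | add x y _ _ hx hy => rw [mul_add]; exact add_mem hx hy
    | smul a x _ hx => rw [mul_smul_comm]; exact Submodule.smul_mem _ _ hx
  have hlead : ∀ i, ∀ α ∈ D, α + epsV i ∈ D →
      ∃ k : ℂ, k ≠ 0 ∧ E i * A α - k • A (α + epsV i) ∈ S A (α + epsV i) := by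
    intro i α hα hαi
    obtain ⟨c, hc, hle, hne⟩ := hstep i α hα
    refine ⟨_, hne hαi, ?_⟩
    show A (epsV i) * A α - _ ∈ _
    rw [hc, ← Finset.add_sum_erase _ _ hαi, add_sub_cancel_left]
    refine Submodule.sum_mem _ fun β hβ => ?_
    rw [Finset.mem_erase] at hβ
    by_cases h : c β = 0
    · simp [h]
    · exact Submodule.smul_mem _ _
        (Submodule.subset_span ⟨β, ⟨hβ.2, hle β hβ.2 h, hβ.1⟩, rfl⟩)
  have hP : ∀ N : ℕ, ∀ α ∈ D, ∑ i, α i = N →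
      ∃ k : ℂ, k ≠ 0 ∧ mpow E α - k • A α ∈ S A α := by
    intro N
    induction N with
    | zero =>
      intro α _ hs
      have h0 : α = 0 := by
        ext i
        exact (Finset.sum_eq_zero_iff.mp hs) i (Finset.mem_univ i)
      subst h0
      exact ⟨1, one_ne_zero, by simp [mpow_zero, hone]⟩
    | succ N ih =>
      intro α hα hs
      obtain ⟨i, β, rfl⟩ := exists_eq_add_epsV (α := α) (by omega)
      have hβ : β ∈ D := hlow _ hα β fun j => by simp
      have hsβ : ∑ j, β j = N := by
        simp only [Pi.add_apply, Finset.sum_add_distrib, epsV, Finset.sum_pi_single',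
          Finset.mem_univ, if_true] at hs
        omega
      obtain ⟨k, hk, hkS⟩ := ih β hβ hsβ
      obtain ⟨k', hk', hkS'⟩ := hlead i β hβ hα
      refine ⟨k * k', mul_ne_zero hk hk', ?_⟩
      have h1 := add_mem (hES i β _ hkS) (Submodule.smul_mem _ k hkS')
      rw [mpow_add_epsV hcomm]
      convert h1 using 1
      rw [mul_sub, mul_smul_comm, smul_sub, mul_smul]
      abel
  have hPA : ∀ α ∈ D, ∃ k : ℂ, k ≠ 0 ∧ mpow E α - k • A α ∈ S A α :=
    fun α hα => hP _ α hα rfl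
  have hAP : ∀ α, α ∈ D → ∃ k : ℂ, k ≠ 0 ∧ A α - k • mpow E α ∈ S (mpow E) α := by
    intro α
    induction α using mo.wf.induction with
    | _ α ih =>
      intro hα
      obtain ⟨k, hk, hkS⟩ := hPA α hα
      have hSS : S A α ≤ S (mpow E) α := by
        refine Submodule.span_le.mpr ?_
        rintro _ ⟨β, ⟨hβ, hβα⟩, rfl⟩
        obtain ⟨k₁, -, hk₁⟩ := ih β hβα hβ
        refine hWS _ hβα ?_
        have := add_mem (hSW _ _ hk₁) (Submodule.smul_mem _ k₁ (hmem (mpow E) β hβ))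
        rwa [sub_add_cancel] at this
      refine ⟨k⁻¹, inv_ne_zero hk, ?_⟩
      have := Submodule.smul_mem _ (-k⁻¹) (hSS hkS)
      convert this using 1
      rw [smul_sub, smul_smul, neg_mul, inv_mul_cancel₀ hk, neg_smul, neg_smul, one_smul]
      abel
  have hWAP : ∀ α, W A α ≤ W (mpow E) α := by
    intro α
    refine Submodule.span_le.mpr ?_
    rintro _ ⟨β, ⟨hβ, hβα⟩, rfl⟩
    obtain ⟨k₁, -, hk₁⟩ := hAP β hβ
    refine hWW _ hβα ?_
    have := add_mem (hSW _ _ hk₁) (Submodule.smul_mem _ k₁ (hmem (mpow E) β hβ))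
    rwa [sub_add_cancel] at this
  refine ⟨hA, heps, hlow, ?_, ?_⟩
  · intro α hα
    obtain ⟨k, hk, hkS⟩ := hAP α hα
    obtain ⟨c, hc, hcle⟩ := (mem_span_image_filter_iff _ _ _ _).mp hkS
    have hcα : c α = 0 := by_contra fun h => (hcle α h).2 rfl
    obtain ⟨v, hv, hvc, hvs⟩ := matEval_sum_monomial D (c + Pi.single α k) E
    refine ⟨v, ?_, ⟨?_, ?_⟩, fun d hd => (hvs d hd).1⟩
    · rw [hv]
      simp only [Pi.add_apply, add_smul, Finset.sum_add_distrib, ← hc]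
      rw [Finset.sum_eq_single_of_mem α hα fun β _ hβ => by simp [hβ]]
      simp
    · rw [hvc α hα]
      simpa [hcα] using hk
    · intro d hd
      by_cases h : ⇑d = α
      · rw [h]; exact mo.le_refl α
      · have := (hvs d hd).2
        rw [Pi.add_apply, Pi.single_eq_of_ne h, add_zero] at this
        exact (hcle _ this).1
  · intro i α hα
    obtain ⟨k, -, hkS⟩ := hPA α hα
    have hW : mpow E α ∈ W A α := by
      have := add_mem (hSW _ _ hkS) (Submodule.smul_mem _ k (hmem A α hα))
      rwa [sub_add_cancel] at this
    obtain ⟨c, hc, hcle⟩ := (mem_span_image_filter_iff _ _ _ _).mp (hWAP _ (hEW i α _ hW))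
    exact ⟨c, hc, fun β _ h => hcle β h⟩

/-- The type of a pair in `Option Y`: which of the entries lie in `Y`, and the `ρ`-label of the
pair if both do. -/
def pairType {Y : Type*} (ρ : Y × Y → ℕ) : Option Y → Option Y → Bool × Bool × ℕ
  | some a, some b => (true, true, ρ (a, b))
  | some _, none => (true, false, 0)
  | none, some _ => (false, true, 0)
  | none, none => (false, false, 0)

/-- Interchange of the two membership flags of a pair type, keeping the label. -/
def flipType (t : Bool × Bool × ℕ) : Bool × Bool × ℕ := (t.2.1, t.1, t.2.2)

/-- The contribution of a single coordinate to the relation label. -/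
def pairVec {Y : Type*} (ρ : Y × Y → ℕ) (m : ℕ) (a b : Option Y) : Fin (m + 1) → ℕ :=
  fun i => if pairType ρ a b = (true, decide (i ≠ 0), (i : ℕ)) then 1 else 0

/-- The number of coordinates at which two words have pair type `t`. -/
def typeCount {Y : Type*} (ρ : Y × Y → ℕ) {n : ℕ} (f g : Fin n → Option Y)
    (t : Bool × Bool × ℕ) : ℕ :=
  (Finset.univ.filter fun c => pairType ρ (f c) (g c) = t).card

/-- The relation label `(t, a₁, …, a_m)` of two words over `Option Y`. -/
def relLabel {Y : Type*} (ρ : Y × Y → ℕ) (m : ℕ) {n : ℕ} (f g : Fin n → Option Y) :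
    Fin (m + 1) → ℕ :=
  fun i => typeCount ρ f g (true, decide (i ≠ 0), (i : ℕ))

/-- The number of coordinates at which a word over `Option Y` takes a value in `Y`. -/
def weight {Y : Type*} {n : ℕ} (f : Fin n → Option Y) : ℕ :=
  (Finset.univ.filter fun c => (f c).isSome).card

section Label

variable {Y : Type*} {ρ : Y × Y → ℕ} {m n : ℕ}

theorem relLabel_eq_sum (f g : Fin n → Option Y) :
    relLabel ρ m f g = ∑ c, pairVec ρ m (f c) (g c) := by
  ext i
  simp only [relLabel, typeCount, Finset.card_filter, Finset.sum_apply, pairVec]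

theorem pairVec_none (b : Option Y) : pairVec ρ m none b = 0 := by
  ext i
  cases b <;> simp [pairVec, pairType]

theorem pairVec_some_none (a : Y) : pairVec ρ m (some a) none = epsV 0 := by
  ext i
  by_cases h : i = 0
  · subst h; simp [pairVec, pairType, epsV]
  · simp [pairVec, pairType, epsV, h]

theorem pairVec_some_some_of_zero {a b : Y} (h : ρ (a, b) = 0) :
    pairVec ρ m (some a) (some b) = 0 := by
  ext i
  by_cases hi : i = 0
  · simp [pairVec, pairType, hi]
  · have : ¬ (0 = (i : ℕ)) := fun h => hi (Fin.ext h.symm)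
    simp [pairVec, pairType, hi, h, this]

theorem pairVec_some_some_of_eq {a b : Y} {i : Fin (m + 1)} (hi : i ≠ 0)
    (h : ρ (a, b) = (i : ℕ)) : pairVec ρ m (some a) (some b) = epsV i := by
  ext j
  by_cases hj : j = i
  · subst hj; simp [pairVec, pairType, epsV, hi, h]
  · have : ¬ ((i : ℕ) = (j : ℕ)) := fun h => hj (Fin.ext h.symm)
    simp [pairVec, pairType, epsV, hj, h, this]

theorem pairVec_self (hρ_diag : ∀ y y' : Y, ρ (y, y') = 0 ↔ y = y') (a : Option Y) :
    pairVec ρ m a a = 0 := by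
  cases a with
  | none => exact pairVec_none _
  | some a => exact pairVec_some_some_of_zero ((hρ_diag a a).mpr rfl)

theorem sum_epsV {ℓ : ℕ} (i : Fin ℓ) : ∑ j, epsV i j = 1 := by
  simp [epsV]

theorem sum_pairVec (hρ_le : ∀ p : Y × Y, ρ p ≤ m)
    (hρ_diag : ∀ y y' : Y, ρ (y, y') = 0 ↔ y = y') (a b : Option Y) :
    ∑ i, pairVec ρ m a b i = if a = none ∨ a = b then 0 else 1 := by
  rcases a with _ | a
  · simp [pairVec_none]
  rcases b with _ | b
  · simp [pairVec_some_none, sum_epsV]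
  by_cases h : ρ (a, b) = 0
  · rw [pairVec_some_some_of_zero h]
    simp [(hρ_diag a b).mp h]
  · have hab : a ≠ b := fun e => h ((hρ_diag a b).mpr e)
    have hi : (⟨ρ (a, b), Nat.lt_succ_of_le (hρ_le _)⟩ : Fin (m + 1)) ≠ 0 :=
      fun e => h (congrArg Fin.val e)
    rw [pairVec_some_some_of_eq hi rfl, sum_epsV]
    simp [hab]

theorem pairVec_apply_zero (a b : Option Y) :
    pairVec ρ m a b 0 = if a ≠ none ∧ b = none then 1 else 0 := by
  rcases a with _ | a <;> rcases b with _ | b <;> simp [pairVec, pairType]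

theorem sum_pairVec_le (hρ_le : ∀ p : Y × Y, ρ p ≤ m)
    (hρ_diag : ∀ y y' : Y, ρ (y, y') = 0 ↔ y = y') (a b c : Option Y) :
    ∑ i, pairVec ρ m a c i ≤ ∑ i, pairVec ρ m a b i + ∑ i, pairVec ρ m b c i := by
  simp only [sum_pairVec hρ_le hρ_diag]
  split_ifs <;> simp_all

theorem pairVec_apply_zero_le (a b c : Option Y) :
    pairVec ρ m a c 0 ≤ pairVec ρ m a b 0 + pairVec ρ m b c 0 := by
  simp only [pairVec_apply_zero]
  split_ifs <;> simp_all

theorem eq_zero_of_sum_eq_zero {ι : Type*} [Fintype ι] {v : ι → ℕ} (h : ∑ i, v i = 0) :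
    v = 0 := by
  ext i
  exact (Finset.sum_eq_zero_iff.mp h) i (Finset.mem_univ i)

theorem eq_epsV_of_sum_eq_one {ℓ : ℕ} {v : Fin ℓ → ℕ} {i : Fin ℓ} (h : ∑ j, v j = 1)
    (hi : v i = 1) : v = epsV i := by
  have h1 : ∑ j ∈ Finset.univ.erase i, v j = 0 := by
    have := Finset.add_sum_erase Finset.univ v (Finset.mem_univ i)
    omega
  ext j
  by_cases hj : j = i
  · subst hj; simp [epsV, hi]
  · simpa [epsV, hj] using (Finset.sum_eq_zero_iff.mp h1) j (by simp [hj])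

theorem eq_zero_or_eq_epsV_of_le {ℓ : ℕ} {v : Fin ℓ → ℕ} {i : Fin ℓ} (h : v ≤ epsV i) :
    v = 0 ∨ v = epsV i := by
  have hj : ∀ j, j ≠ i → v j = 0 := fun j hj => by simpa [epsV, hj] using h j
  have hi : v i ≤ 1 := by simpa [epsV] using h i
  rcases Nat.le_one_iff_eq_zero_or_eq_one.mp hi with h0 | h1
  · left; ext j; by_cases e : j = i
    · rw [e, h0]; rfl
    · exact hj j e
  · right; ext j; by_cases e : j = i
    · rw [e, h1]; simp [epsV]
    · simp [epsV, e, hj j e]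

theorem pairVec_eq_add (hρ_le : ∀ p : Y × Y, ρ p ≤ m)
    (hρ_diag : ∀ y y' : Y, ρ (y, y') = 0 ↔ y = y') {a b c : Option Y} {i : Fin (m + 1)}
    (hab : pairVec ρ m a b ≤ epsV i)
    (hsum : ∑ j, pairVec ρ m a c j = ∑ j, pairVec ρ m a b j + ∑ j, pairVec ρ m b c j)
    (hzero : i = 0 → pairVec ρ m a c 0 = pairVec ρ m a b 0 + pairVec ρ m b c 0) :
    pairVec ρ m a c = pairVec ρ m a b + pairVec ρ m b c := by
  rcases eq_zero_or_eq_epsV_of_le hab with h | h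
  · have h0 : a = none ∨ a = b := by
      have := sum_pairVec hρ_le hρ_diag a b
      rw [h] at this
      by_contra hne
      simp [hne] at this
    rcases h0 with rfl | rfl
    · simp only [pairVec_none, Pi.zero_apply, Finset.sum_const_zero, zero_add] at hsum ⊢
      exact (eq_zero_of_sum_eq_zero hsum.symm).symm
    · rw [h, zero_add]
  · have hs1 : ∑ j, pairVec ρ m a c j ≤ 1 := by
      rw [sum_pairVec hρ_le hρ_diag]; split_ifs <;> simp
    have hs2 : ∑ j, pairVec ρ m a b j = 1 := by rw [h, sum_epsV]
    have hbc : pairVec ρ m b c = 0 := eq_zero_of_sum_eq_zero (by omega)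
    rw [hbc, add_zero]
    by_cases hi : i = 0
    · subst hi
      rw [h]
      refine eq_epsV_of_sum_eq_one (by omega) ?_
      rw [hzero rfl, hbc, h]
      simp [epsV]
    · have h1 := sum_pairVec hρ_le hρ_diag b c
      rw [hbc] at h1
      have h2 : b = none ∨ b = c := by
        by_contra hne
        simp [hne] at h1
      rcases h2 with rfl | rfl
      · have h3 : pairVec ρ m a none 0 = 0 := by rw [h]; simp [epsV, Ne.symm hi]
        rcases a with _ | a
        · simp [pairVec_none] at hs2
        · simp [pairVec_some_none, epsV] at h3
      · rfl

theorem relLabel_grlexLe (hρ_le : ∀ p : Y × Y, ρ p ≤ m)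
    (hρ_diag : ∀ y y' : Y, ρ (y, y') = 0 ↔ y = y') {f g k : Fin n → Option Y}
    {i : Fin (m + 1)} (hfg : relLabel ρ m f g = epsV i) :
    grlexLe (relLabel ρ m f k) (relLabel ρ m g k + epsV i) := by
  have hsum : ∀ u v : Fin n → Option Y, ∑ j, relLabel ρ m u v j =
      ∑ c, ∑ j, pairVec ρ m (u c) (v c) j := by
    intro u v
    rw [relLabel_eq_sum, Finset.sum_comm]
    simp
  have hle : ∀ c, pairVec ρ m (f c) (g c) ≤ epsV i := by
    intro c
    rw [← hfg, relLabel_eq_sum]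
    exact Finset.single_le_sum (f := fun c => pairVec ρ m (f c) (g c))
      (fun _ _ => zero_le) (Finset.mem_univ c)
  have hpt : ∀ c ∈ Finset.univ, ∑ j, pairVec ρ m (f c) (k c) j ≤
      ∑ j, pairVec ρ m (f c) (g c) j + ∑ j, pairVec ρ m (g c) (k c) j :=
    fun c _ => sum_pairVec_le hρ_le hρ_diag _ _ _
  have hpt0 : ∀ c ∈ Finset.univ, pairVec ρ m (f c) (k c) 0 ≤
      pairVec ρ m (f c) (g c) 0 + pairVec ρ m (g c) (k c) 0 :=
    fun c _ => pairVec_apply_zero_le _ _ _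
  have htot : ∑ j, relLabel ρ m f k j ≤ ∑ j, (relLabel ρ m g k + epsV i) j := by
    simp only [Pi.add_apply, Finset.sum_add_distrib]
    rw [← hfg, add_comm (∑ j, relLabel ρ m g k j), hsum, hsum, hsum, ← Finset.sum_add_distrib]
    exact Finset.sum_le_sum hpt
  have htot0 : relLabel ρ m f k 0 ≤ (relLabel ρ m g k + relLabel ρ m f g) 0 := by
    rw [add_comm (relLabel ρ m g k), Pi.add_apply, relLabel_eq_sum, relLabel_eq_sum, relLabel_eq_sum]
    simp only [Finset.sum_apply, ← Finset.sum_add_distrib]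
    exact Finset.sum_le_sum hpt0
  rcases htot.lt_or_eq with hlt | heq
  · exact Or.inl hlt
  refine Or.inr ⟨heq, ?_⟩
  have hadd : (i = 0 → relLabel ρ m f k 0 = (relLabel ρ m g k + relLabel ρ m f g) 0) →
      relLabel ρ m f k = relLabel ρ m g k + epsV i := by
    intro h0
    rw [← hfg, add_comm (relLabel ρ m g k)]
    simp only [relLabel_eq_sum]
    rw [← Finset.sum_add_distrib]
    refine Finset.sum_congr rfl fun c _ => pairVec_eq_add hρ_le hρ_diag (hle c) ?_ ?_
    · refine (Finset.sum_eq_sum_iff_of_le hpt).mp ?_ c (Finset.mem_univ c)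
      rw [Finset.sum_add_distrib, ← hsum, ← hsum, ← hsum, heq, hfg]
      simp [Finset.sum_add_distrib, add_comm]
    · intro hi
      have := h0 hi
      refine (Finset.sum_eq_sum_iff_of_le hpt0).mp ?_ c (Finset.mem_univ c)
      simp only [relLabel_eq_sum, Pi.add_apply, Finset.sum_apply] at this
      rw [Finset.sum_add_distrib, this, add_comm]
  by_cases h0 : relLabel ρ m f k 0 = (relLabel ρ m g k + relLabel ρ m f g) 0
  · exact Or.inl (hadd fun _ => h0)
  · by_cases hi : i = 0
    · refine Or.inr ⟨0, fun j hj => absurd hj (Fin.not_lt_zero j), ?_⟩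
      rw [← hfg]
      exact lt_of_le_of_ne htot0 h0
    · exact Or.inl (hadd fun h => absurd h hi)

end Label

section Counting

variable {Y : Type*} {ρ : Y × Y → ℕ} {m n : ℕ}

theorem typeCount_add_sum_typeCount (hρ_le : ∀ p : Y × Y, ρ p ≤ m) (f g : Fin n → Option Y) :
    typeCount ρ f g (true, false, 0) +
      ∑ k ∈ Finset.range (m + 1), typeCount ρ f g (true, true, k) = weight f := by
  simp only [typeCount, weight, Finset.card_filter]
  rw [Finset.sum_comm, ← Finset.sum_add_distrib]
  refine Finset.sum_congr rfl fun c _ => ?_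
  rcases f c with _ | a <;> rcases g c with _ | b <;> simp [pairType]
  exact hρ_le (a, b)

theorem typeCount_add_sum_typeCount' (hρ_le : ∀ p : Y × Y, ρ p ≤ m) (f g : Fin n → Option Y) :
    typeCount ρ f g (false, true, 0) +
      ∑ k ∈ Finset.range (m + 1), typeCount ρ f g (true, true, k) = weight g := by
  simp only [typeCount, weight, Finset.card_filter]
  rw [Finset.sum_comm, ← Finset.sum_add_distrib]
  refine Finset.sum_congr rfl fun c _ => ?_
  rcases f c with _ | a <;> rcases g c with _ | b <;> simp [pairType]
  exact hρ_le (a, b)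

theorem typeCount_false_add_weight (f g : Fin n → Option Y) :
    typeCount ρ f g (false, false, 0) + typeCount ρ f g (false, true, 0) + weight f = n := by
  simp only [typeCount, weight, Finset.card_filter]
  rw [← Finset.sum_add_distrib, ← Finset.sum_add_distrib]
  refine (Finset.sum_congr rfl fun c _ => ?_).trans (Finset.card_eq_sum_ones Finset.univ).symm |>.trans
    (Finset.card_fin n)
  rcases f c with _ | a <;> rcases g c with _ | b <;> simp [pairType]

theorem typeCount_eq_zero (f g : Fin n → Option Y) {x y : Bool} {k : ℕ}
    (hxy : ¬ (x = true ∧ y = true)) (hk : k ≠ 0) : typeCount ρ f g (x, y, k) = 0 := by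
  rw [typeCount, Finset.card_eq_zero, Finset.filter_eq_empty_iff]
  intro c _
  rcases f c with _ | a <;> rcases g c with _ | b <;> (simp [pairType, hk.symm]; try grind)

theorem typeCount_eq_zero_of_lt (hρ_le : ∀ p : Y × Y, ρ p ≤ m) (f g : Fin n → Option Y) {k : ℕ}
    (hk : m < k) : typeCount ρ f g (true, true, k) = 0 := by
  rw [typeCount, Finset.card_eq_zero, Finset.filter_eq_empty_iff]
  intro c _
  rcases f c with _ | a <;> rcases g c with _ | b <;> simp [pairType]
  exact fun h => absurd (hρ_le (a, b)) (by omega)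

theorem relLabel_zero (f g : Fin n → Option Y) :
    relLabel ρ m f g 0 = typeCount ρ f g (true, false, 0) := by
  simp [relLabel]

theorem relLabel_succ (f g : Fin n → Option Y) (i : Fin m) :
    relLabel ρ m f g i.succ = typeCount ρ f g (true, true, (i : ℕ) + 1) := by
  simp [relLabel]

theorem sum_typeCount (f g : Fin n → Option Y) :
    ∑ k ∈ Finset.range (m + 1), typeCount ρ f g (true, true, k) =
      ∑ i : Fin m, relLabel ρ m f g i.succ + typeCount ρ f g (true, true, 0) := by
  rw [Finset.sum_range_succ', Finset.sum_range]
  simp only [relLabel_succ]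

theorem mem_gjD_iff {h : ℕ} {α : Fin (m + 1) → ℕ} :
    α ∈ gjD n h m ↔ α 0 ≤ n - h ∧ ∑ i, α i ≤ h := by
  simp only [gjD, Finset.mem_filter, Fintype.mem_piFinset, Finset.mem_range, Fin.sum_univ_succ,
    le_min_iff]
  constructor
  · rintro ⟨-, ⟨h1, h2⟩, h3⟩
    exact ⟨h2, by omega⟩
  · rintro ⟨h1, h2⟩
    refine ⟨fun i => ?_, ⟨by omega, h1⟩, by omega⟩
    have := Finset.single_le_sum (f := α) (fun _ _ => Nat.zero_le _) (Finset.mem_univ i)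
    rw [Fin.sum_univ_succ] at this
    omega

theorem sum_relLabel_add (hρ_le : ∀ p : Y × Y, ρ p ≤ m) (f g : Fin n → Option Y) :
    ∑ i, relLabel ρ m f g i + typeCount ρ f g (true, true, 0) = weight f := by
  rw [← typeCount_add_sum_typeCount hρ_le f g, sum_typeCount, Fin.sum_univ_succ, relLabel_zero,
    add_assoc]

theorem typeCount_swap (hρ_le : ∀ p : Y × Y, ρ p ≤ m) {f g : Fin n → Option Y}
    (hw : weight f = weight g) : typeCount ρ f g (false, true, 0) = relLabel ρ m f g 0 := by
  have h1 := typeCount_add_sum_typeCount hρ_le f g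
  have h2 := typeCount_add_sum_typeCount' hρ_le f g
  rw [relLabel_zero]
  omega

theorem typeCount_flipType (hρ_le : ∀ p : Y × Y, ρ p ≤ m) {f g : Fin n → Option Y}
    (hw : weight f = weight g) (t : Bool × Bool × ℕ) :
    typeCount ρ f g (flipType t) = typeCount ρ f g t := by
  obtain ⟨x, y, k⟩ := t
  have h1 := typeCount_swap hρ_le hw
  rw [relLabel_zero] at h1
  by_cases hk : k = 0
  · subst hk
    cases x <;> cases y <;> simp [flipType, h1]
  · cases x <;> cases y <;> simp [flipType, typeCount_eq_zero, hk]

theorem relLabel_mem_gjD (hρ_le : ∀ p : Y × Y, ρ p ≤ m) {h : ℕ} {f g : Fin n → Option Y}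
    (hf : weight f = h) (hg : weight g = h) : relLabel ρ m f g ∈ gjD n h m := by
  have h1 := sum_relLabel_add hρ_le f g
  have h2 := typeCount_swap hρ_le (hf.trans hg.symm)
  have h3 := typeCount_false_add_weight (ρ := ρ) f g
  rw [mem_gjD_iff]
  constructor <;> omega

theorem typeCount_eq_of_relLabel_eq (hρ_le : ∀ p : Y × Y, ρ p ≤ m) {h : ℕ}
    {f g f' g' : Fin n → Option Y} (hf : weight f = h) (hg : weight g = h)
    (hf' : weight f' = h) (hg' : weight g' = h)
    (hrel : relLabel ρ m f g = relLabel ρ m f' g') (t : Bool × Bool × ℕ) :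
    typeCount ρ f g t = typeCount ρ f' g' t := by
  have h1 := sum_relLabel_add hρ_le f g
  have h1' := sum_relLabel_add hρ_le f' g'
  have h2 := typeCount_swap hρ_le (hf.trans hg.symm)
  have h2' := typeCount_swap hρ_le (hf'.trans hg'.symm)
  have h3 := typeCount_false_add_weight (ρ := ρ) f g
  have h3' := typeCount_false_add_weight (ρ := ρ) f' g'
  have h4 := relLabel_zero (ρ := ρ) (m := m) f g
  have h4' := relLabel_zero (ρ := ρ) (m := m) f' g'
  rw [hrel] at h1 h2 h4
  obtain ⟨x, y, k⟩ := t
  rcases k with _ | k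
  · cases x <;> cases y <;> omega
  · by_cases hxy : x = true ∧ y = true
    · obtain ⟨rfl, rfl⟩ := hxy
      by_cases hk : k < m
      · have := congrFun hrel (Fin.succ ⟨k, hk⟩)
        rwa [relLabel_succ, relLabel_succ] at this
      · rw [typeCount_eq_zero_of_lt hρ_le _ _ (by omega),
          typeCount_eq_zero_of_lt hρ_le _ _ (by omega)]
    · rw [typeCount_eq_zero _ _ hxy (by omega), typeCount_eq_zero _ _ hxy (by omega)]

theorem exists_of_typeCount_pos {f g : Fin n → Option Y} {t : Bool × Bool × ℕ}
    (h : 0 < typeCount ρ f g t) : ∃ c, pairType ρ (f c) (g c) = t := by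
  obtain ⟨c, hc⟩ := Finset.card_pos.mp h
  exact ⟨c, (Finset.mem_filter.mp hc).2⟩

theorem relLabel_eq_add_of_forall {f g f' g' : Fin n → Option Y} {i : Fin (m + 1)} {c : Fin n}
    (H : ∀ j, pairVec ρ m (f j) (g j) =
      pairVec ρ m (f' j) (g' j) + if j = c then epsV i else 0) :
    relLabel ρ m f g = relLabel ρ m f' g' + epsV i := by
  rw [relLabel_eq_sum, relLabel_eq_sum, Finset.sum_congr rfl fun j _ => H j,
    Finset.sum_add_distrib]
  simp

theorem relLabel_self (hρ_diag : ∀ y y' : Y, ρ (y, y') = 0 ↔ y = y') (f : Fin n → Option Y) :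
    relLabel ρ m f f = 0 := by
  rw [relLabel_eq_sum]
  exact Finset.sum_eq_zero fun c _ => pairVec_self hρ_diag _

theorem eq_of_relLabel_eq_zero (hρ_le : ∀ p : Y × Y, ρ p ≤ m)
    (hρ_diag : ∀ y y' : Y, ρ (y, y') = 0 ↔ y = y') {f g : Fin n → Option Y}
    (hw : weight f = weight g) (hfg : relLabel ρ m f g = 0) : f = g := by
  have h1 := typeCount_swap hρ_le hw
  rw [hfg] at h1
  ext1 c
  have h2 : ∑ i, pairVec ρ m (f c) (g c) i = 0 := by
    have : pairVec ρ m (f c) (g c) ≤ 0 := by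
      rw [← hfg, relLabel_eq_sum]
      exact Finset.single_le_sum (f := fun c => pairVec ρ m (f c) (g c))
        (fun _ _ => zero_le) (Finset.mem_univ c)
    exact Finset.sum_eq_zero fun i _ => Nat.le_zero.mp (this i)
  rw [sum_pairVec hρ_le hρ_diag] at h2
  have h3 : f c = none ∨ f c = g c := by
    by_contra hne
    simp [hne] at h2
  rcases h3 with h3 | h3
  · by_contra hne
    rw [typeCount, Pi.zero_apply, Finset.card_eq_zero, Finset.filter_eq_empty_iff] at h1
    refine h1 (Finset.mem_univ c) ?_
    rw [h3] at hne ⊢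
    rcases hg : g c with _ | b
    · exact absurd hg.symm hne
    · rfl
  · exact h3

theorem pairType_eq_zero_iff (hρ_diag : ∀ y y' : Y, ρ (y, y') = 0 ↔ y = y') {a b : Option Y} :
    pairType ρ a b = (true, true, 0) ↔ ∃ y, a = some y ∧ b = some y := by
  rcases a with _ | a <;> rcases b with _ | b
  · simp [pairType]
  · simp [pairType]
  · simp [pairType]
  · simp only [pairType, Prod.mk.injEq, true_and, hρ_diag, Option.some.injEq]
    exact ⟨fun e => ⟨a, rfl, e.symm⟩, fun ⟨y, e, e'⟩ => e.trans e'.symm⟩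

theorem pairType_eq_false_iff {a b : Option Y} :
    pairType ρ a b = (false, false, 0) ↔ a = none ∧ b = none := by
  rcases a with _ | a <;> rcases b with _ | b <;> simp [pairType]

theorem exists_relLabel_add (hρ_le : ∀ p : Y × Y, ρ p ≤ m)
    (hρ_diag : ∀ y y' : Y, ρ (y, y') = 0 ↔ y = y')
    (hρ_ex : ∀ i ≤ m, ∀ y' : Y, ∃ y, ρ (y, y') = i) {h : ℕ} {g k : Fin n → Option Y}
    (hg : weight g = h) (hk : weight k = h) {i : Fin (m + 1)}
    (hD : relLabel ρ m g k + epsV i ∈ gjD n h m) :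
    ∃ f : Fin n → Option Y, weight f = h ∧ relLabel ρ m f g = epsV i ∧
      relLabel ρ m f k = relLabel ρ m g k + epsV i := by
  have h1 := sum_relLabel_add hρ_le g k
  have h2 := typeCount_swap hρ_le (hg.trans hk.symm)
  have h3 := typeCount_false_add_weight (ρ := ρ) g k
  rw [mem_gjD_iff] at hD
  simp only [Pi.add_apply, Finset.sum_add_distrib, sum_epsV] at hD
  obtain ⟨c, hc⟩ := exists_of_typeCount_pos (ρ := ρ) (f := g) (g := k) (t := (true, true, 0))
    (by omega)
  obtain ⟨y', hgc, hkc⟩ := (pairType_eq_zero_iff hρ_diag).mp hc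
  have hself : ∀ a, pairVec ρ m a a = 0 := pairVec_self hρ_diag
  by_cases hi : i = 0
  · subst hi
    have he : epsV (0 : Fin (m + 1)) 0 = 1 := by simp [epsV]
    obtain ⟨d, hd⟩ := exists_of_typeCount_pos (ρ := ρ) (f := g) (g := k)
      (t := (false, false, 0)) (by omega)
    obtain ⟨hgd, hkd⟩ := pairType_eq_false_iff.mp hd
    have hcd : c ≠ d := by
      rintro rfl
      rw [hgc] at hgd
      cases hgd
    set f : Fin n → Option Y := fun j => if j = c then none else if j = d then some y' else g j
      with hf
    refine ⟨f, ?_, ?_, ?_⟩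
    · rw [← hg]
      refine Finset.card_bij' (fun j _ => Equiv.swap c d j) (fun j _ => Equiv.swap c d j)
        ?_ ?_ ?_ ?_
      · intro j hj
        simp only [Finset.mem_filter, Finset.mem_univ, true_and, hf] at hj ⊢
        by_cases hjc : j = c
        · simp [hjc] at hj
        · by_cases hjd : j = d
          · subst hjd; simp [hgc]
          · simpa [Equiv.swap_apply_of_ne_of_ne hjc hjd, hjc, hjd] using hj
      · intro j hj
        simp only [Finset.mem_filter, Finset.mem_univ, true_and, hf] at hj ⊢
        by_cases hjc : j = c
        · subst hjc; simp [Ne.symm hcd]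
        · by_cases hjd : j = d
          · subst hjd; simp [hgd] at hj
          · simpa [Equiv.swap_apply_of_ne_of_ne hjc hjd, hjc, hjd] using hj
      · intro j _; simp
      · intro j _; simp
    · rw [← zero_add (epsV 0), ← relLabel_self hρ_diag g]
      refine relLabel_eq_add_of_forall (c := d) fun j => ?_
      by_cases hjc : j = c
      · subst hjc; simp [hf, pairVec_none, hself, hcd]
      · by_cases hjd : j = d
        · subst hjd; simp [hf, hjc, hgd, pairVec_some_none, hself]
        · simp [hf, hjc, hjd]
    · refine relLabel_eq_add_of_forall (c := d) fun j => ?_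
      by_cases hjc : j = c
      · subst hjc; simp [hf, pairVec_none, hself, hcd, hgc, hkc]
      · by_cases hjd : j = d
        · subst hjd; simp [hf, hjc, hgd, hkd, pairVec_some_none, hself]
        · simp [hf, hjc, hjd]
  · obtain ⟨y, hy⟩ := hρ_ex i (Nat.le_of_lt_succ i.isLt) y'
    have hv := pairVec_some_some_of_eq hi hy
    refine ⟨Function.update g c (some y), ?_, ?_, ?_⟩
    · rw [← hg, weight, weight]
      congr 1
      refine Finset.filter_congr fun j _ => ?_
      by_cases hjc : j = c
      · subst hjc; simp [hgc]
      · simp [hjc]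
    · rw [← zero_add (epsV i), ← relLabel_self hρ_diag g]
      refine relLabel_eq_add_of_forall (c := c) fun j => ?_
      by_cases hjc : j = c
      · subst hjc; simp [hgc, hv, hself]
      · simp [hjc]
    · refine relLabel_eq_add_of_forall (c := c) fun j => ?_
      by_cases hjc : j = c
      · subst hjc; simp [hgc, hkc, hv, hself]
      · simp [hjc]

end Counting

section Symmetry

variable {Y : Type*} {ρ : Y × Y → ℕ} {m n : ℕ}

theorem exists_perm_comp_eq {α T : Type*} [Fintype α] [DecidableEq T] (u v : α → T)
    (h : ∀ t, (Finset.univ.filter fun a => u a = t).card =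
      (Finset.univ.filter fun a => v a = t).card) :
    ∃ σ : Equiv.Perm α, ∀ a, u (σ a) = v a := by
  refine ⟨Equiv.ofFiberEquiv (f := v) (g := u) fun t => Fintype.equivOfCardEq ?_,
    Equiv.ofFiberEquiv_map _⟩
  rw [Fintype.card_subtype, Fintype.card_subtype, h]

theorem exists_equiv_of_coord {X : Type*} [Fintype X] {h : ℕ} {enc : X → Fin n → Option Y}
    (hinj : Function.Injective enc) (hrange : ∀ f, (∃ x, enc x = f) ↔ weight f = h)
    (τ : Equiv.Perm (Fin n)) (φ : Fin n → Option Y ≃ Option Y)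
    (hφ : ∀ c b, (φ c b).isSome = b.isSome) :
    ∃ e : X ≃ X, ∀ x c, enc (e x) c = φ c (enc x (τ c)) := by
  have hex : ∀ x, ∃ x', enc x' = fun c => φ c (enc x (τ c)) := by
    intro x
    rw [hrange, ← (hrange (enc x)).mp ⟨x, rfl⟩]
    refine Finset.card_bij' (fun j _ => τ j) (fun j _ => τ.symm j) ?_ ?_ ?_ ?_ <;>
      simp [hφ]
  choose e he using hex
  have hei : Function.Injective e := by
    intro x x' hxx
    apply hinj
    ext1 c
    have := congrFun ((he x).symm.trans ((congrArg enc hxx).trans (he x'))) (τ.symm c)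
    simpa using this
  exact ⟨Equiv.ofBijective e (Finite.injective_iff_bijective.mp hei),
    fun x c => congrFun (he x) c⟩

theorem exists_equiv_of_pairType_eq {F : Type*} [Group F] [MulAction F Y]
    (htrans : MulAction.IsPretransitive F Y)
    (hρ_inv : ∀ (g : F) (y y' : Y), ρ (g • y, g • y') = ρ (y, y'))
    (hρ_orbit : ∀ p q : Y × Y, ρ p = ρ q → ∃ g : F, (g • p.1, g • p.2) = q)
    {a b a' b' : Option Y} (h : pairType ρ a b = pairType ρ a' b') :
    ∃ φ : Option Y ≃ Option Y, φ a = a' ∧ φ b = b' ∧ (∀ u, (φ u).isSome = u.isSome) ∧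
      ∀ u v, pairType ρ (φ u) (φ v) = pairType ρ u v := by
  have hg : ∃ g : F, Option.map (g • ·) a = a' ∧ Option.map (g • ·) b = b' := by
    rcases a with _ | a <;> rcases b with _ | b <;> rcases a' with _ | a' <;>
      rcases b' with _ | b' <;> simp [pairType] at h ⊢
    · exact MulAction.exists_smul_eq F b b'
    · exact MulAction.exists_smul_eq F a a'
    · simpa using hρ_orbit _ _ h
  obtain ⟨g, hga, hgb⟩ := hg
  refine ⟨Equiv.optionCongr (MulAction.toPerm g), hga, hgb, ?_, ?_⟩
  · intro u
    cases u <;> rfl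
  · intro u v
    rcases u with _ | u <;> rcases v with _ | v <;> simp [pairType, hρ_inv]

theorem exists_equiv_of_relLabel_eq {F : Type*} [Group F] [MulAction F Y]
    (htrans : MulAction.IsPretransitive F Y) (hρ_le : ∀ p : Y × Y, ρ p ≤ m)
    (hρ_inv : ∀ (g : F) (y y' : Y), ρ (g • y, g • y') = ρ (y, y'))
    (hρ_orbit : ∀ p q : Y × Y, ρ p = ρ q → ∃ g : F, (g • p.1, g • p.2) = q)
    {X : Type*} [Fintype X] {h : ℕ} {enc : X → Fin n → Option Y}
    (hinj : Function.Injective enc) (hrange : ∀ f, (∃ x, enc x = f) ↔ weight f = h)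
    {x y x' y' : X}
    (hrel : relLabel ρ m (enc x) (enc y) = relLabel ρ m (enc x') (enc y')) :
    ∃ e : X ≃ X, e x = x' ∧ e y = y' ∧
      ∀ u v, relLabel ρ m (enc (e u)) (enc (e v)) = relLabel ρ m (enc u) (enc v) := by
  have hw : ∀ x, weight (enc x) = h := fun x => (hrange _).mp ⟨x, rfl⟩
  obtain ⟨τ, hτ⟩ := exists_perm_comp_eq (fun c => pairType ρ (enc x c) (enc y c))
    (fun c => pairType ρ (enc x' c) (enc y' c))
    (typeCount_eq_of_relLabel_eq hρ_le (hw x) (hw y) (hw x') (hw y') hrel)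
  choose φ hφx hφy hφs hφ using fun c =>
    exists_equiv_of_pairType_eq htrans hρ_inv hρ_orbit (hτ c)
  obtain ⟨e, he⟩ := exists_equiv_of_coord hinj hrange τ φ hφs
  refine ⟨e, hinj (funext fun c => (he x c).trans (hφx c)),
    hinj (funext fun c => (he y c).trans (hφy c)), fun u v => ?_⟩
  rw [relLabel_eq_sum, relLabel_eq_sum,
    ← Equiv.sum_comp τ fun c => pairVec ρ m (enc u c) (enc v c)]
  refine Finset.sum_congr rfl fun c _ => ?_
  ext i
  rw [he, he, pairVec, pairVec, hφ]

theorem card_triangle_eq [Fintype Y] [DecidableEq Y] (hρ_le : ∀ p : Y × Y, ρ p ≤ m)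
    (hYscheme : IsAssocScheme fun i : Fin (m + 1) =>
      Matrix.of fun y y' : Y => if ρ (y, y') = (i : ℕ) then (1 : ℂ) else 0)
    {a d a' d' : Y} (had : ρ (a', d') = ρ (a, d)) (i j : ℕ) :
    (Finset.univ.filter fun b => ρ (a', b) = i ∧ ρ (b, d') = j).card =
      (Finset.univ.filter fun b => ρ (a, b) = j ∧ ρ (b, d) = i).card := by
  by_cases hi : m < i
  · rw [Finset.filter_eq_empty_iff.mpr, Finset.filter_eq_empty_iff.mpr]
    · rintro b - ⟨-, h⟩
      have := hρ_le (b, d)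
      omega
    · rintro b - ⟨h, -⟩
      have := hρ_le (a', b)
      omega
  by_cases hj : m < j
  · rw [Finset.filter_eq_empty_iff.mpr, Finset.filter_eq_empty_iff.mpr]
    · rintro b - ⟨h, -⟩
      have := hρ_le (a, b)
      omega
    · rintro b - ⟨-, h⟩
      have := hρ_le (b, d')
      omega
  set B : Fin (m + 1) → Matrix Y Y ℂ := fun i =>
    Matrix.of fun y y' : Y => if ρ (y, y') = (i : ℕ) then (1 : ℂ) else 0 with hB
  have hmul : ∀ (i j : Fin (m + 1)) (y z : Y), (B i * B j) y z =
      ((Finset.univ.filter fun b => ρ (y, b) = i ∧ ρ (b, z) = j).card : ℂ) := by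
    intro i j y z
    rw [Matrix.mul_apply, Finset.card_filter, Nat.cast_sum]
    refine Finset.sum_congr rfl fun b _ => ?_
    by_cases h1 : ρ (y, b) = i <;> by_cases h2 : ρ (b, z) = j <;> simp [hB, h1, h2]
  obtain ⟨p, hp⟩ := hYscheme.mul_eq_lin ⟨i, by omega⟩ ⟨j, by omega⟩
  have hc := hYscheme.mul_comm' ⟨i, by omega⟩ ⟨j, by omega⟩
  have h1 := hmul ⟨i, by omega⟩ ⟨j, by omega⟩ a' d'
  have h2 := hmul ⟨j, by omega⟩ ⟨i, by omega⟩ a d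
  have h3 : (B ⟨i, by omega⟩ * B ⟨j, by omega⟩) a' d' =
      (B ⟨j, by omega⟩ * B ⟨i, by omega⟩) a d := by
    rw [← hc, hp]
    simp only [Matrix.sum_apply, Matrix.smul_apply, hB, Matrix.of_apply, had]
  rw [h1, h2] at h3
  exact_mod_cast h3

theorem card_row_eq_card_col [Fintype Y] [DecidableEq Y] (hρ_le : ∀ p : Y × Y, ρ p ≤ m)
    (hYscheme : IsAssocScheme fun i : Fin (m + 1) =>
      Matrix.of fun y y' : Y => if ρ (y, y') = (i : ℕ) then (1 : ℂ) else 0)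
    (a d : Y) (i : ℕ) :
    (Finset.univ.filter fun b => ρ (a, b) = i).card =
      (Finset.univ.filter fun b => ρ (b, d) = i).card := by
  rw [Finset.card_eq_sum_card_fiberwise (f := fun b => ρ (b, d)) (t := Finset.range (m + 1))
      (fun b _ => by simpa using Nat.lt_succ_of_le (hρ_le (b, d))),
    Finset.card_eq_sum_card_fiberwise (f := fun b => ρ (a, b)) (t := Finset.range (m + 1))
      (fun b _ => by simpa using Nat.lt_succ_of_le (hρ_le (a, b)))]
  refine Finset.sum_congr rfl fun j _ => ?_
  rw [Finset.filter_filter, Finset.filter_filter, card_triangle_eq hρ_le hYscheme rfl i j]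
  simp only [and_comm]

theorem exists_equiv_flipType [Fintype Y] [DecidableEq Y] (hρ_le : ∀ p : Y × Y, ρ p ≤ m)
    (hYscheme : IsAssocScheme fun i : Fin (m + 1) =>
      Matrix.of fun y y' : Y => if ρ (y, y') = (i : ℕ) then (1 : ℂ) else 0)
    {a d a' d' : Option Y} (h : pairType ρ a' d' = flipType (pairType ρ a d)) :
    ∃ φ : Option Y ≃ Option Y, (∀ b, (φ b).isSome = b.isSome) ∧
      ∀ b, pairType ρ a' (φ b) = flipType (pairType ρ b d) ∧
        pairType ρ (φ b) d' = flipType (pairType ρ a b) := by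
  have hs : ∀ (ψ : Y ≃ Y) (b : Option Y), (Equiv.optionCongr ψ b).isSome = b.isSome := by
    intro ψ b
    cases b <;> rfl
  rcases a with _ | a <;> rcases d with _ | d <;> rcases a' with _ | a' <;>
    rcases d' with _ | d' <;> simp [pairType, flipType] at h
  · refine ⟨Equiv.refl _, fun _ => rfl, fun b => ?_⟩
    cases b <;> simp [pairType, flipType]
  · obtain ⟨ψ, hψ⟩ := exists_perm_comp_eq (fun b => ρ (a', b)) (fun b => ρ (b, d))
      (card_row_eq_card_col hρ_le hYscheme a' d)
    refine ⟨Equiv.optionCongr ψ, hs ψ, fun b => ?_⟩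
    cases b <;> simp [pairType, flipType, hψ]
  · obtain ⟨ψ, hψ⟩ := exists_perm_comp_eq (fun b => ρ (b, d')) (fun b => ρ (a, b))
      (fun i => (card_row_eq_card_col hρ_le hYscheme a d' i).symm)
    refine ⟨Equiv.optionCongr ψ, hs ψ, fun b => ?_⟩
    cases b <;> simp [pairType, flipType, hψ]
  · obtain ⟨ψ, hψ⟩ := exists_perm_comp_eq (fun b => (ρ (a', b), ρ (b, d')))
      (fun b => (ρ (b, d), ρ (a, b))) (fun t => by
        simpa [Prod.ext_iff, and_comm] using card_triangle_eq hρ_le hYscheme h t.1 t.2)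
    simp only [Prod.mk.injEq] at hψ
    refine ⟨Equiv.optionCongr ψ, hs ψ, fun b => ?_⟩
    cases b <;> simp [pairType, flipType, hψ]

theorem exists_equiv_relLabel_swap [Fintype Y] [DecidableEq Y] (hρ_le : ∀ p : Y × Y, ρ p ≤ m)
    (hYscheme : IsAssocScheme fun i : Fin (m + 1) =>
      Matrix.of fun y y' : Y => if ρ (y, y') = (i : ℕ) then (1 : ℂ) else 0)
    {X : Type*} [Fintype X] {h : ℕ} {enc : X → Fin n → Option Y}
    (hinj : Function.Injective enc) (hrange : ∀ f, (∃ x, enc x = f) ↔ weight f = h)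
    (x z : X) :
    ∃ e : X ≃ X, ∀ y, relLabel ρ m (enc x) (enc (e y)) = relLabel ρ m (enc y) (enc z) ∧
      relLabel ρ m (enc (e y)) (enc z) = relLabel ρ m (enc x) (enc y) := by
  have hw : ∀ x y, weight (enc x) = weight (enc y) := fun x y =>
    ((hrange _).mp ⟨x, rfl⟩).trans ((hrange _).mp ⟨y, rfl⟩).symm
  have hflip : ∀ s t, flipType s = t ↔ s = flipType t :=
    fun s t => ⟨fun e => e ▸ rfl, fun e => e ▸ rfl⟩
  obtain ⟨τ, hτ⟩ := exists_perm_comp_eq (fun c => flipType (pairType ρ (enc x c) (enc z c)))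
    (fun c => pairType ρ (enc x c) (enc z c)) (fun t => by
      simp only [hflip]
      exact typeCount_flipType hρ_le (hw x z) t)
  choose φ hφs hφ using fun c => exists_equiv_flipType hρ_le hYscheme (hτ c).symm
  obtain ⟨e, he⟩ := exists_equiv_of_coord hinj hrange τ φ hφs
  have hcount : ∀ (u v u' v' : Fin n → Option Y), weight u = weight v →
      (∀ c, pairType ρ (u' c) (v' c) = flipType (pairType ρ (u (τ c)) (v (τ c)))) →
      relLabel ρ m u' v' = relLabel ρ m u v := by
    intro u v u' v' huv H
    ext i
    rw [relLabel, relLabel, ← typeCount_flipType hρ_le huv]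
    refine Finset.card_bij' (fun j _ => τ j) (fun j _ => τ.symm j) ?_ ?_ ?_ ?_ <;>
      simp [H, hflip]
  refine ⟨e, fun y => ⟨hcount _ _ _ _ (hw y z) fun c => ?_, hcount _ _ _ _ (hw x y) fun c => ?_⟩⟩
  · rw [he]
    exact (hφ c _).1
  · rw [he]
    exact (hφ c _).2

end Symmetry

/-- The scheme of words of fixed weight over `Option Y`, for any enumeration `enc` of them. -/
theorem isMultiPPoly_of_enc {F : Type*} [Group F] {Y : Type*}
    [Fintype Y] [DecidableEq Y] [MulAction F Y]
    (htrans : MulAction.IsPretransitive F Y)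
    {m : ℕ} {ρ : Y × Y → ℕ}
    (hρ_surj : ∀ i ≤ m, ∃ p : Y × Y, ρ p = i)
    (hρ_le : ∀ p : Y × Y, ρ p ≤ m)
    (hρ_inv : ∀ (g : F) (y y' : Y), ρ (g • y, g • y') = ρ (y, y'))
    (hρ_orbit : ∀ p q : Y × Y, ρ p = ρ q → ∃ g : F, (g • p.1, g • p.2) = q)
    (hρ_diag : ∀ y y' : Y, ρ (y, y') = 0 ↔ y = y')
    (hYscheme : IsAssocScheme fun i : Fin (m + 1) =>
      Matrix.of fun y y' : Y => if ρ (y, y') = (i : ℕ) then (1 : ℂ) else 0)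
    {n h : ℕ} (hh : 1 ≤ h) (hhn : h < n)
    {mo : MonOrder (m + 1)} (hmo : mo.le = fun a b => grlexLe a b)
    {X : Type*} [Fintype X] [DecidableEq X] {enc : X → Fin n → Option Y}
    (hinj : Function.Injective enc) (hrange : ∀ f, (∃ x, enc x = f) ↔ weight f = h)
    {A : (Fin (m + 1) → ℕ) → Matrix X X ℂ}
    (hA : ∀ α x y, A α x y = if relLabel ρ m (enc x) (enc y) = α then 1 else 0) :
    IsMultiPPoly (gjD n h m) mo A := by
  have hw : ∀ x, weight (enc x) = h := fun x => (hrange _).mp ⟨x, rfl⟩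
  have hρ_ex : ∀ i ≤ m, ∀ y' : Y, ∃ y, ρ (y, y') = i := by
    intro i hi y'
    obtain ⟨p, hp⟩ := hρ_surj i hi
    obtain ⟨g, hg⟩ := MulAction.exists_smul_eq F p.2 y'
    exact ⟨g • p.1, by rw [← hg, hρ_inv, hp]⟩
  have hmem : ∀ x y, relLabel ρ m (enc x) (enc y) ∈ gjD n h m :=
    fun x y => relLabel_mem_gjD hρ_le (hw x) (hw y)
  have heps : ∀ i : Fin (m + 1), epsV i ∈ gjD n h m := by
    intro i
    rw [mem_gjD_iff, sum_epsV]
    refine ⟨?_, hh⟩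
    have : epsV i 0 ≤ 1 := by
      by_cases hi : i = 0
      · simp [epsV, hi]
      · simp [epsV, Ne.symm hi]
    omega
  have hlow : ∀ α ∈ gjD n h m, ∀ β : Fin (m + 1) → ℕ, (∀ i, β i ≤ α i) → β ∈ gjD n h m := by
    intro α hα β hβ
    rw [mem_gjD_iff] at hα ⊢
    exact ⟨(hβ 0).trans hα.1, (Finset.sum_le_sum fun i _ => hβ i).trans hα.2⟩
  have hone : A 0 = 1 := by
    ext x y
    rw [hA, Matrix.one_apply]
    congr 1
    refine propext ⟨fun e =>
      hinj (eq_of_relLabel_eq_zero hρ_le hρ_diag ((hw x).trans (hw y).symm) e), ?_⟩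
    rintro rfl
    exact relLabel_self hρ_diag _
  have hext : ∀ {i α x y}, relLabel ρ m (enc x) (enc y) = α → α + epsV i ∈ gjD n h m →
      ∃ x', relLabel ρ m (enc x') (enc x) = epsV i ∧
        relLabel ρ m (enc x') (enc y) = α + epsV i := by
    rintro i α x y rfl hD
    obtain ⟨f, hf, hf1, hf2⟩ := exists_relLabel_add hρ_le hρ_diag hρ_ex (hw x) (hw y) hD
    obtain ⟨x', rfl⟩ := (hrange f).mpr hf
    exact ⟨x', hf1, hf2⟩
  have hreal : ∀ N : ℕ, ∀ α ∈ gjD n h m, ∑ i, α i = N →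
      ∃ x y, relLabel ρ m (enc x) (enc y) = α := by
    intro N
    induction N with
    | zero =>
      intro α _ hs
      obtain ⟨p, -⟩ := hρ_surj 0 (Nat.zero_le m)
      obtain ⟨x, -⟩ := (hrange fun c => if (c : ℕ) < h then some p.1 else none).mpr (by
        have : ∀ c : Fin n, ((if (c : ℕ) < h then some p.1 else none).isSome = true) ↔
            (c : ℕ) < h := by
          intro c
          by_cases hc : (c : ℕ) < h <;> simp [hc]
        simp only [weight, this]
        rw [Fin.card_filter_val_lt]
        omega)
      exact ⟨x, x, by rw [relLabel_self hρ_diag, eq_zero_of_sum_eq_zero hs]⟩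
    | succ N ih =>
      intro α hα hs
      obtain ⟨i, β, rfl⟩ := exists_eq_add_epsV (α := α) (by omega)
      simp only [Pi.add_apply, Finset.sum_add_distrib, sum_epsV] at hs
      obtain ⟨x, y, hxy⟩ := ih β (hlow _ hα β fun j => by simp) (by omega)
      obtain ⟨x', -, hx'⟩ := hext hxy hα
      exact ⟨x', y, hx'⟩
  have horb : ∀ {x y x' y'}, relLabel ρ m (enc x) (enc y) = relLabel ρ m (enc x') (enc y') →
      ∃ e : X ≃ X, e x = x' ∧ e y = y' ∧
        ∀ u v, relLabel ρ m (enc (e u)) (enc (e v)) = relLabel ρ m (enc u) (enc v) :=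
    exists_equiv_of_relLabel_eq htrans hρ_le hρ_inv hρ_orbit hinj hrange
  have hmul : ∀ α β x z, (A α * A β) x z = ((Finset.univ.filter fun y =>
      relLabel ρ m (enc x) (enc y) = α ∧ relLabel ρ m (enc y) (enc z) = β).card : ℂ) := by
    intro α β x z
    rw [Matrix.mul_apply, Finset.card_filter, Nat.cast_sum]
    refine Finset.sum_congr rfl fun y _ => ?_
    rw [hA, hA]
    by_cases h1 : relLabel ρ m (enc x) (enc y) = α <;>
      by_cases h2 : relLabel ρ m (enc y) (enc z) = β <;> simp [h1, h2]
  have hmul_inv : ∀ α β {x z x' z'},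
      relLabel ρ m (enc x) (enc z) = relLabel ρ m (enc x') (enc z') →
      (A α * A β) x z = (A α * A β) x' z' := by
    intro α β x z x' z' hrel
    obtain ⟨e, rfl, rfl, he⟩ := horb hrel
    rw [Matrix.mul_apply, Matrix.mul_apply,
      ← Equiv.sum_comp e fun y => A α (e x) y * A β y (e z)]
    simp only [hA, he]
  have : Nonempty X := by
    obtain ⟨x, -⟩ := hreal _ 0 (hlow _ (heps 0) 0 fun _ => Nat.zero_le _) rfl
    exact ⟨x⟩
  choose! rx ry hr using fun α hα => hreal _ α hα rfl
  have hlin : ∀ α β, A α * A β =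
      ∑ γ ∈ gjD n h m, (A α * A β) (rx γ) (ry γ) • A γ := by
    intro α β
    ext x z
    rw [Matrix.sum_apply, Finset.sum_eq_single_of_mem _ (hmem x z)]
    · rw [Matrix.smul_apply, hA _ x z, if_pos rfl, smul_eq_mul, mul_one]
      exact hmul_inv α β (hr _ (hmem x z)).symm
    · intro γ _ hγ
      rw [Matrix.smul_apply, hA _ x z, if_neg hγ.symm, smul_zero]
  have hscheme : IsAssocScheme fun α : {a // a ∈ gjD n h m} => A α.1 := by
    refine ⟨?_, ?_, ?_, ?_, ?_, ?_⟩
    · intro α x y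
      rw [hA]
      exact (ite_eq_or_eq _ _ _).symm
    · rw [Finset.sum_coe_sort (gjD n h m) A]
      ext x y
      rw [Matrix.sum_apply]
      simp [hA, hmem, matJ]
    · exact ⟨⟨0, hlow _ (heps 0) 0 fun _ => Nat.zero_le _⟩, hone⟩
    · rintro ⟨α, hα⟩
      refine ⟨⟨relLabel ρ m (enc (ry α)) (enc (rx α)), hmem _ _⟩, ?_⟩
      ext x y
      rw [Matrix.transpose_apply, hA, hA]
      congr 1
      refine propext ⟨fun e => ?_, fun e => ?_⟩
      · obtain ⟨s, rfl, rfl, hs⟩ := horb ((hr α hα).trans e.symm)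
        exact hs _ _
      · obtain ⟨s, rfl, rfl, hs⟩ := horb e.symm
        rw [hs, hr α hα]
    · rintro ⟨α, hα⟩ ⟨β, hβ⟩
      refine ⟨fun γ => (A α * A β) (rx γ.1) (ry γ.1), ?_⟩
      rw [Finset.sum_coe_sort (gjD n h m) fun γ => (A α * A β) (rx γ) (ry γ) • A γ]
      exact hlin α β
    · rintro ⟨α, hα⟩ ⟨β, hβ⟩
      ext x z
      obtain ⟨e, he⟩ := exists_equiv_relLabel_swap (ρ := ρ) hρ_le hYscheme hinj hrange x z
      rw [Matrix.mul_apply, Matrix.mul_apply, ← Equiv.sum_comp e fun y => A β x y * A α y z]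
      simp only [hA, he]
      exact Finset.sum_congr rfl fun y _ => mul_comm _ _
  refine IsMultiPPoly.of_triangular hscheme heps hlow hone fun i α hα =>
    ⟨_, hlin _ _, fun β hβ hne => ?_, fun hαi => ?_⟩
  · rw [hmul, Nat.cast_ne_zero, Finset.card_ne_zero] at hne
    obtain ⟨y, hy⟩ := hne
    obtain ⟨-, hy1, hy2⟩ := Finset.mem_filter.mp hy
    rw [hmo, ← hr β hβ, ← hy2]
    exact relLabel_grlexLe hρ_le hρ_diag hy1
  · obtain ⟨x', h1, h2⟩ := hext (hr α hα) hαi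
    rw [hmul_inv _ _ ((hr _ hαi).trans h2.symm), hmul, Nat.cast_ne_zero, Finset.card_ne_zero]
    exact ⟨rx α, Finset.mem_filter.mpr ⟨Finset.mem_univ _, h1, hr α hα⟩⟩

/-- A partial function `θ : A → Y` as a word over `Option Y`. -/
def thetaWord {Y : Type*} {n h : ℕ} (θ : Theta Y n h) : Fin n → Option Y :=
  fun c => if hc : c ∈ θ.1.1 then some (θ.2 ⟨c, hc⟩) else none

theorem thetaWord_of_mem {Y : Type*} {n h : ℕ} {θ : Theta Y n h} {c : Fin n}
    (hc : c ∈ θ.1.1) : thetaWord θ c = some (θ.2 ⟨c, hc⟩) :=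
  dif_pos hc

theorem thetaWord_of_notMem {Y : Type*} {n h : ℕ} {θ : Theta Y n h} {c : Fin n}
    (hc : c ∉ θ.1.1) : thetaWord θ c = none :=
  dif_neg hc

theorem isSome_thetaWord {Y : Type*} {n h : ℕ} (θ : Theta Y n h) (c : Fin n) :
    (thetaWord θ c).isSome = true ↔ c ∈ θ.1.1 := by
  by_cases hc : c ∈ θ.1.1 <;> simp [thetaWord, hc]

theorem thetaWord_injective {Y : Type*} {n h : ℕ} :
    Function.Injective (thetaWord : Theta Y n h → Fin n → Option Y) := by
  rintro ⟨⟨s, hs⟩, u⟩ ⟨⟨s', hs'⟩, u'⟩ e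
  obtain rfl : s = s' := by
    ext c
    have h1 := isSome_thetaWord ⟨⟨s, hs⟩, u⟩ c
    rw [e, isSome_thetaWord] at h1
    exact h1.symm
  congr 1
  ext c
  have := congrFun e c.1
  simpa [thetaWord, c.2] using this

theorem exists_thetaWord_eq_iff {Y : Type*} {n h : ℕ} (f : Fin n → Option Y) :
    (∃ θ : Theta Y n h, thetaWord θ = f) ↔ weight f = h := by
  constructor
  · rintro ⟨θ, rfl⟩
    simp only [weight, isSome_thetaWord, Finset.filter_univ_mem]
    exact θ.1.2
  · intro hf
    refine ⟨⟨⟨Finset.univ.filter fun c => (f c).isSome, hf⟩,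
      fun c => (f c.1).get (Finset.mem_filter.mp c.2).2⟩, ?_⟩
    ext1 c
    by_cases hc : (f c).isSome
    · simp [thetaWord, hc]
    · simp [thetaWord, Option.not_isSome_iff_eq_none.mp hc]

theorem gjA_apply {Y : Type*} [Fintype Y] [DecidableEq Y] (ρ : Y × Y → ℕ) {n h m : ℕ}
    (α : Fin (m + 1) → ℕ) (θ₁ θ₂ : Theta Y n h) :
    gjA Y ρ n h m α θ₁ θ₂ =
      if relLabel ρ m (thetaWord θ₁) (thetaWord θ₂) = α then 1 else 0 := by
  have hzero : relLabel ρ m (thetaWord θ₁) (thetaWord θ₂) 0 = (θ₁.1.1 \ θ₂.1.1).card := by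
    rw [relLabel_zero, typeCount]
    congr 1
    ext c
    rw [Finset.mem_filter_univ]
    by_cases h1 : c ∈ θ₁.1.1 <;> by_cases h2 : c ∈ θ₂.1.1 <;>
      simp [thetaWord_of_mem, thetaWord_of_notMem, pairType, h1, h2]
  have hcard : (θ₁.1.1 ∩ θ₂.1.1).card + (θ₁.1.1 \ θ₂.1.1).card = h :=
    (Finset.card_inter_add_card_sdiff _ _).trans θ₁.1.2
  have hsucc : ∀ i : Fin m, relLabel ρ m (thetaWord θ₁) (thetaWord θ₂) i.succ =
      ((θ₁.1.1 ∩ θ₂.1.1).attach.filter fun c =>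
        ρ (θ₁.2 ⟨c.1, (Finset.mem_inter.mp c.2).1⟩,
          θ₂.2 ⟨c.1, (Finset.mem_inter.mp c.2).2⟩) = (i : ℕ) + 1).card := by
    intro i
    rw [relLabel_succ, typeCount, ← Finset.card_map (Function.Embedding.subtype _)]
    congr 1
    ext c
    rw [Finset.mem_filter_univ]
    by_cases h1 : c ∈ θ₁.1.1 <;> by_cases h2 : c ∈ θ₂.1.1 <;>
      simp [thetaWord_of_mem, thetaWord_of_notMem, pairType, h1, h2]
  rw [gjA, Matrix.of_apply]
  refine if_congr ⟨fun H => ?_, ?_⟩ rfl rfl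
  · ext i
    refine Fin.cases ?_ (fun i => ?_) i
    · have := H.1
      omega
    · rw [hsucc, H.2]
  · rintro rfl
    exact ⟨by rw [hzero, hcard], fun i => (hsucc i).symm⟩

/-- Theorem 4.8: for a finite Gelfand pair `(F, H)` with `Y = F/H` having `H`-orbits
`Λ_0 = {y₀}, Λ_1, …, Λ_m`, the generalized Johnson scheme `𝔛 = (Θ_h, ℛ)` is an
`(m+1)`-variate `P`-polynomial association scheme on `D` with respect to the graded
lexicographic order. Here the `F`-orbits of `Y × Y` are labeled by `ρ : Y × Y → {0, 1, …, m}`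
(with `Λ̃_0` the diagonal), and the Gelfand-pair condition is expressed by the commutativity
of the orbit scheme on `Y`. -/
theorem generalizedJohnson_isMultiPPoly {F : Type*} [Group F] {Y : Type*}
    [Fintype Y] [DecidableEq Y] [MulAction F Y]
    (htrans : MulAction.IsPretransitive F Y)
    (m : ℕ) (ρ : Y × Y → ℕ)
    (hρ_surj : ∀ i ≤ m, ∃ p : Y × Y, ρ p = i)
    (hρ_le : ∀ p : Y × Y, ρ p ≤ m)
    (hρ_inv : ∀ (g : F) (y y' : Y), ρ (g • y, g • y') = ρ (y, y'))
    (hρ_orbit : ∀ p q : Y × Y, ρ p = ρ q → ∃ g : F, (g • p.1, g • p.2) = q)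
    (hρ_diag : ∀ y y' : Y, ρ (y, y') = 0 ↔ y = y')
    (hYscheme : IsAssocScheme fun i : Fin (m + 1) =>
      Matrix.of fun y y' : Y => if ρ (y, y') = (i : ℕ) then (1 : ℂ) else 0)
    (n h : ℕ) (hh : 1 ≤ h) (hhn : h < n)
    (mo : MonOrder (m + 1)) (hmo : mo.le = fun a b => grlexLe a b) :
    IsMultiPPoly (gjD n h m) mo (gjA Y ρ n h m) := by
  exact isMultiPPoly_of_enc htrans hρ_surj hρ_le hρ_inv hρ_orbit hρ_diag hYscheme hh hhn hmo
    thetaWord_injective exists_thetaWord_eq_iff (gjA_apply ρ)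

end GeneralizedJohnson
end
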